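/- Assume (H1)-(H3) and (J1)-(J2), let τ>0, β>0, and let φ be a traveling wavefront of the delayed nonlocal dispersion equation with speed c>c*, where c* is the minimal wave speed. Suppose the initial data u₀ satisfies u₋≤u₀(s,x)≤u₊ for all (s,x)∈[−τ,0]×ℝⁿ, and that (s,x)↦u₀(s,x)−φ(x₁+cs) belongs to C([−τ,0]; H^m_w(ℝⁿ)∩L¹_w(ℝⁿ)) with ∂_s(u₀−φ)∈L¹([−τ,0]; H^m_w(ℝⁿ)∩L¹_w(ℝⁿ)) for some m>n/2. Then the solution u of the Cauchy problem uniquely exists, and there exist constants C>0, ε₁=ε₁(τ)∈(0,1), and μ_τ with 0<μ_τ<min{d'(u₊)−b'(u₊), ε₁[G_c(λ*)−H_c(λ*)]}, such that sup_{x∈ℝⁿ}|u(t,x)−φ(x₁+ct)| ≤ C(1+t)^{−n/α} e^{−μ_τ t} for all t>0. -/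

import Mathlib

open MeasureTheory Real Set Filter Asymptotics

noncomputable section

abbrev Rn (n : ℕ) := EuclideanSpace ℝ (Fin n)

/-- The delayed exponential function `e_τ^{kt}`: it equals `0` for `t < -τ`,
and `∑_{j=0}^{m} k^j (t-(j-1)τ)^j / j!` for `(m-1)τ ≤ t < mτ` (where for
`t ≥ -τ` one has `m = ⌊t/τ⌋ + 1`). -/
noncomputable def delayedExp (τ k t : ℝ) : ℝ :=
  if t < -τ then 0
  else ∑ j ∈ Finset.range (⌊t / τ⌋ + 2).toNat,
      k ^ j * (t - ((j : ℝ) - 1) * τ) ^ j / (Nat.factorial j : ℝ)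

/-- Fourier transform of a real kernel on ℝⁿ: `Ĵ(η) = ∫ e^{-i y·η} J(y) dy`. -/
noncomputable def FT {n : ℕ} (J : Rn n → ℝ) (η : Rn n) : ℂ :=
  ∫ y, Complex.exp (-Complex.I * ((inner ℝ y η : ℝ) : ℂ)) * (J y : ℂ)

/-- The n-dimensional heat kernel `f_β(y) = (4πβ)^{-n/2} e^{-|y|²/(4β)}`. -/
noncomputable def heatKernel (n : ℕ) (β : ℝ) (y : Rn n) : ℝ :=
  (4 * Real.pi * β) ^ (-(n : ℝ) / 2) * Real.exp (-‖y‖ ^ 2 / (4 * β))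

/-- The one-dimensional heat kernel `f_{1β}`. -/
noncomputable def heatKernel1 (β : ℝ) (y : ℝ) : ℝ :=
  (4 * Real.pi * β) ^ (-(1 : ℝ) / 2) * Real.exp (-y ^ 2 / (4 * β))

/-- Partial derivative in the `i`-th coordinate direction. -/
noncomputable def pd {n : ℕ} (i : Fin n) (f : Rn n → ℝ) : Rn n → ℝ :=
  fun x => fderiv ℝ f x (EuclideanSpace.single i 1)

/-- Multi-index partial derivative `∂^j_x`. -/
noncomputable def mpd {n : ℕ} (j : Fin n → ℕ) (f : Rn n → ℝ) : Rn n → ℝ :=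
  ((List.ofFn fun i : Fin n => (pd i)^[j i]).foldr (· ∘ ·) id) f

/-- Square of the (unweighted) Sobolev `H^m` norm:
`∑_{|j| ≤ m} ∫ |∂^j f|²`. -/
noncomputable def HSobSq {n : ℕ} (m : ℕ) (f : Rn n → ℝ) : ℝ :=
  ∑ j ∈ Finset.univ.filter (fun j : Fin n → Fin (m + 1) => (∑ i, (j i : ℕ)) ≤ m),
    ∫ x, (mpd (fun i => (j i : ℕ)) f x) ^ 2

/-- Square of the weighted Sobolev `H^m_w` norm, with a weight depending on the
first coordinate: `∑_{|j| ≤ m} ∫ w(x₁) |∂^j f|²`. -/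
noncomputable def HSobSqW {n : ℕ} [NeZero n] (w : ℝ → ℝ) (m : ℕ) (f : Rn n → ℝ) : ℝ :=
  ∑ j ∈ Finset.univ.filter (fun j : Fin n → Fin (m + 1) => (∑ i, (j i : ℕ)) ≤ m),
    ∫ x, w (x 0) * (mpd (fun i => (j i : ℕ)) f x) ^ 2

/-- The weight function `w(x₁) = e^{-λ*(x₁-x*)}` for `x₁ ≤ x*`, `= 1` for `x₁ > x*`. -/
noncomputable def wgt (lamstar xstar x1 : ℝ) : ℝ :=
  if x1 ≤ xstar then Real.exp (-lamstar * (x1 - xstar)) else 1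


lemma ode_le {g B : ℝ → ℝ} {B' : ℝ → ℝ} {a t : ℝ} (hat : a ≤ t) (hga : g a ≤ 0)
    (hc : ContinuousOn g (Icc a t)) (hB : ∀ s, HasDerivAt B (B' s) s)
    (hB0 : ∀ s ∈ Icc a t, 0 ≤ B s)
    (h : ∀ s ∈ Ioo a t, 0 < g s → ∃ g', HasDerivAt g g' s ∧ g' ≤ B' s) : g t ≤ B t := by
  by_cases hgt : g t ≤ 0
  · exact hgt.trans (hB0 t ⟨hat, le_rfl⟩)
  push Not at hgt
  set Z := {s ∈ Icc a t | g s ≤ 0} with hZ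
  have hZc : IsClosed Z := by
    have := hc.preimage_isClosed_of_isClosed isClosed_Icc (isClosed_Iic (a := (0:ℝ)))
    exact this
  have hne : Z.Nonempty := ⟨a, ⟨le_rfl, hat⟩, hga⟩
  have hbd : BddAbove Z := ⟨t, fun s hs => hs.1.2⟩
  have hm := hZc.csSup_mem hne hbd
  set a0 := sSup Z
  have hpos : ∀ s ∈ Ioc a0 t, 0 < g s := by
    intro s hs
    by_contra hcon
    push Not at hcon
    have : s ≤ a0 := le_csSup hbd ⟨⟨hm.1.1.trans hs.1.le, hs.2⟩, hcon⟩
    linarith [hs.1]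
  have hd : ∀ s ∈ Ioo a0 t, ∃ g', HasDerivAt g g' s ∧ g' ≤ B' s := fun s hs =>
    h s ⟨hm.1.1.trans_lt hs.1, hs.2⟩ (hpos s ⟨hs.1, hs.2.le⟩)
  have hBc : Continuous B := continuous_iff_continuousAt.2 fun s => (hB s).continuousAt
  have hanti : AntitoneOn (fun s => g s - B s) (Icc a0 t) := by
    apply antitoneOn_of_deriv_nonpos (convex_Icc _ _)
    · exact (hc.mono (Icc_subset_Icc_left hm.1.1)).sub hBc.continuousOn
    · rw [interior_Icc]
      intro s hs
      obtain ⟨g', h1, -⟩ := hd s hs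
      exact (h1.sub (hB s)).differentiableAt.differentiableWithinAt
    · rw [interior_Icc]
      intro s hs
      obtain ⟨g', h1, h2⟩ := hd s hs
      have := (h1.sub (hB s)).deriv
      change deriv (g - B) s ≤ 0
      rw [this]; linarith
  have := hanti ⟨le_rfl, hm.1.2⟩ ⟨hm.1.2, le_rfl⟩ hm.1.2
  simp only at this
  linarith [hm.2, hB0 a0 hm.1]

lemma cmp_lemma {X : Type*} (q : ℝ → X → ℝ) (T T1 L0 M : ℝ) (hL0 : 0 < L0)
    (hM : ∀ t ∈ Icc T T1, ∀ x, q t x ≤ M)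
    (H : ∀ S ≥ 0, (∀ s ∈ Icc T T1, ∀ x, q s x ≤ S * exp (2 * L0 * s)) →
      ∀ t ∈ Icc T T1, ∀ x, 0 < q t x → ∃ a, T ≤ a ∧ a ≤ t ∧ q a x ≤ 0 ∧
        ContinuousOn (fun s => q s x) (Icc a t) ∧
        ∀ s ∈ Ioo a t, 0 < q s x → ∃ q', HasDerivAt (fun s => q s x) q' s ∧
          q' ≤ L0 * (S * exp (2 * L0 * s))) :
    ∀ t ∈ Icc T T1, ∀ x, q t x ≤ 0 := by
  have key : ∀ S ≥ 0, (∀ s ∈ Icc T T1, ∀ x, q s x ≤ S * exp (2 * L0 * s)) →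
      (∀ s ∈ Icc T T1, ∀ x, q s x ≤ (S / 2) * exp (2 * L0 * s)) := by
    intro S hS hb t ht x
    by_cases hq : q t x ≤ 0
    · exact hq.trans (by positivity)
    push Not at hq
    obtain ⟨a, hTa, hat, hqa, hcont, hder⟩ := H S hS hb t ht x hq
    refine ode_le (B := fun s => (S / 2) * exp (2 * L0 * s))
      (B' := fun s => L0 * (S * exp (2 * L0 * s))) hat hqa hcont ?_ ?_ hder
    · intro s
      have h1 : HasDerivAt (fun s : ℝ => 2 * L0 * s) (2 * L0) s := by
        simpa using (hasDerivAt_id s).const_mul (2 * L0)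
      have h2 := h1.exp.const_mul (S / 2)
      have h3 : S / 2 * (exp (2 * L0 * s) * (2 * L0)) = L0 * (S * exp (2 * L0 * s)) := by ring
      rw [h3] at h2
      exact h2
    · intro s _; positivity
  have hall : ∀ k : ℕ, ∀ s ∈ Icc T T1, ∀ x,
      q s x ≤ (max M 0 * exp (-(2 * L0 * T)) / 2 ^ k) * exp (2 * L0 * s) := by
    intro k
    induction k with
    | zero =>
      intro s hs x
      have h1 : (1:ℝ) ≤ exp (-(2 * L0 * T)) * exp (2 * L0 * s) := by
        rw [← exp_add]
        apply one_le_exp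
        nlinarith [hs.1]
      calc q s x ≤ max M 0 := (hM s hs x).trans (le_max_left _ _)
        _ ≤ max M 0 * (exp (-(2 * L0 * T)) * exp (2 * L0 * s)) :=
          le_mul_of_one_le_right (le_max_right _ _) h1
        _ = _ := by simp; ring
    | succ k ih =>
      have h0 : (0:ℝ) ≤ max M 0 * exp (-(2 * L0 * T)) / 2 ^ k :=
        div_nonneg (mul_nonneg (le_max_right _ _) (exp_pos _).le) (by positivity)
      have := key _ h0 ih
      intro s hs x
      refine (this s hs x).trans (le_of_eq ?_)
      rw [pow_succ]; ring
  intro t ht x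
  have hlim : Tendsto (fun k : ℕ => (max M 0 * exp (-(2 * L0 * T)) / 2 ^ k) * exp (2 * L0 * t))
      atTop (nhds 0) := by
    have h1 : Tendsto (fun k : ℕ => ((1:ℝ)/2) ^ k) atTop (nhds 0) :=
      tendsto_pow_atTop_nhds_zero_of_lt_one (by norm_num) (by norm_num)
    have h2 := h1.const_mul (max M 0 * exp (-(2 * L0 * T)) * exp (2 * L0 * t))
    rw [mul_zero] at h2
    refine h2.congr fun k => ?_
    rw [one_div, inv_pow]; field_simp
  exact ge_of_tendsto' hlim fun k => hall k t ht x

/-- convolution form -/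
noncomputable def cv {n : ℕ} (k g : Rn n → ℝ) (x : Rn n) : ℝ := ∫ y, k y * g (x - y)

/-- probability kernels -/
structure Kern {n : ℕ} (k : Rn n → ℝ) : Prop where
  nonneg : ∀ y, 0 ≤ k y
  int : Integrable k
  one : ∫ y, k y = 1

lemma Kern.integrable_mul {n : ℕ} {k : Rn n → ℝ} (hk : Kern k) {g : Rn n → ℝ}
    (hg : AEStronglyMeasurable g) {M : ℝ} (hM : ∀ y, |g y| ≤ M) :
    Integrable (fun y => k y * g y) := by
  have := hk.int.bdd_mul (c := M) hg (Eventually.of_forall fun y => by simpa using hM y)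
  simpa [mul_comm] using this

lemma Kern.cv_int {n : ℕ} {k : Rn n → ℝ} (hk : Kern k) {g : Rn n → ℝ}
    (hg : Measurable g) {M : ℝ} (hM : ∀ y, |g y| ≤ M) (x : Rn n) :
    Integrable (fun y => k y * g (x - y)) :=
  hk.integrable_mul (g := fun y => g (x - y))
    (hg.comp (measurable_const.sub measurable_id)).aestronglyMeasurable (fun y => hM _)

lemma Kern.int_const {n : ℕ} {k : Rn n → ℝ} (hk : Kern k) (a : ℝ) :
    ∫ y, k y * a = a := by
  rw [integral_mul_const, hk.one, one_mul]

section prodkern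
variable {n : ℕ}

lemma prod_integrable (k : Fin n → ℝ → ℝ) (hk : ∀ i, Integrable (k i)) :
    Integrable (fun x : Rn n => ∏ i, k i (x i)) := by
  have h := Integrable.fintype_prod (f := k) (μ := fun _ => (volume : Measure ℝ)) hk
  rw [← volume_pi] at h
  exact (PiLp.volume_preserving_ofLp (Fin n)).integrable_comp_of_integrable h

lemma prod_integral (k : Fin n → ℝ → ℝ) :
    ∫ x : Rn n, ∏ i, k i (x i) = ∏ i, ∫ y, k i y := by
  rw [← integral_fintype_prod_volume_eq_prod]
  exact (PiLp.volume_preserving_ofLp (Fin n)).integral_comp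
    (MeasurableEquiv.toLp 2 (Fin n → ℝ)).symm.measurableEmbedding
    (fun x => ∏ i, k i (x i))

lemma prod_upd [NeZero n] (k : Fin n → ℝ → ℝ) (g : ℝ → ℝ) (x : Rn n) :
    (∏ i, k i (x i)) * g (x 0) = ∏ i, (Function.update k 0 (fun y => k 0 y * g y)) i (x i) := by
  rw [← Finset.mul_prod_erase _ _ (Finset.mem_univ (0 : Fin n)),
    ← Finset.mul_prod_erase (f := fun i => (Function.update k 0 (fun y => k 0 y * g y)) i (x i)) _
      (Finset.mem_univ (0 : Fin n))]
  have : ∏ i ∈ Finset.univ.erase (0 : Fin n), (Function.update k 0 (fun y => k 0 y * g y)) i (x i)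
      = ∏ i ∈ Finset.univ.erase (0 : Fin n), k i (x i) := by
    apply Finset.prod_congr rfl
    intro i hi
    rw [Function.update_of_ne (Finset.ne_of_mem_erase hi)]
  rw [this, Function.update_self]
  ring

lemma prod_integrable0 [NeZero n] (k : Fin n → ℝ → ℝ) (hk : ∀ i, Integrable (k i)) (g : ℝ → ℝ)
    (hg : Integrable (fun y => k 0 y * g y)) :
    Integrable (fun x : Rn n => (∏ i, k i (x i)) * g (x 0)) := by
  simp_rw [prod_upd]
  apply prod_integrable
  intro i
  by_cases hi : i = 0
  · subst hi; rw [Function.update_self]; exact hg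
  · rw [Function.update_of_ne hi]; exact hk i

lemma prod_integral0 [NeZero n] (k : Fin n → ℝ → ℝ) (h1 : ∀ i, ∫ y, k i y = 1) (g : ℝ → ℝ) :
    ∫ x : Rn n, (∏ i, k i (x i)) * g (x 0) = ∫ y, k 0 y * g y := by
  simp_rw [prod_upd]
  rw [prod_integral, ← Finset.mul_prod_erase _ _ (Finset.mem_univ (0 : Fin n)),
    Function.update_self]
  rw [Finset.prod_eq_one, mul_one]
  intro i hi
  rw [Function.update_of_ne (Finset.ne_of_mem_erase hi)]
  exact h1 i

end prodkern

lemma integrable_of_int_one {α : Type*} [MeasurableSpace α] {μ : Measure α} {f : α → ℝ}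
    (h : ∫ y, f y ∂μ = 1) : Integrable f μ := by
  by_contra hc
  rw [integral_undef hc] at h
  exact zero_ne_one h

lemma Kern.of_prod {n : ℕ} {k : Fin n → ℝ → ℝ} (h0 : ∀ i y, 0 ≤ k i y)
    (h1 : ∀ i, ∫ y, k i y = 1) : Kern (fun x : Rn n => ∏ i, k i (x i)) where
  nonneg := fun y => Finset.prod_nonneg fun i _ => h0 i _
  int := prod_integrable k fun i => integrable_of_int_one (h1 i)
  one := by rw [prod_integral]; exact Finset.prod_eq_one fun i _ => h1 i

lemma heat_eq_prod (n : ℕ) {β : ℝ} (hβ : 0 < β) (y : Rn n) :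
    heatKernel n β y = ∏ i, heatKernel1 β (y i) := by
  unfold heatKernel heatKernel1
  rw [Finset.prod_mul_distrib, Finset.prod_const, ← Real.exp_sum, EuclideanSpace.norm_sq_eq]
  congr 1
  · rw [← Real.rpow_natCast, ← Real.rpow_mul (by positivity)]
    congr 1
    simp; ring
  · congr 1
    rw [← Finset.sum_div, Finset.sum_neg_distrib]
    simp

lemma heat1_exp_sq {β : ℝ} (hβ : 0 < β) (l y : ℝ) :
    heatKernel1 β y * exp (-l * y) = exp (β * l ^ 2) * heatKernel1 β (y + 2 * β * l) := by
  unfold heatKernel1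
  rw [mul_assoc, ← exp_add, mul_left_comm, ← exp_add]
  congr 2
  field_simp
  ring

lemma heat1_one {β : ℝ} (hβ : 0 < β) : ∫ y, heatKernel1 β y = 1 := by
  unfold heatKernel1
  rw [integral_const_mul]
  have : (fun y : ℝ => exp (-y ^ 2 / (4 * β))) = fun y => exp (-(1 / (4 * β)) * y ^ 2) := by
    ext y; congr 1; ring
  rw [this, integral_gaussian, Real.sqrt_eq_rpow]
  have h4 : π / (1 / (4 * β)) = 4 * π * β := by field_simp
  rw [h4, ← Real.rpow_add (by positivity)]
  norm_num

lemma heat1_nonneg {β : ℝ} (hβ : 0 < β) (y : ℝ) : 0 ≤ heatKernel1 β y := by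
  unfold heatKernel1; positivity

lemma heat1_exp_int {β : ℝ} (hβ : 0 < β) (l : ℝ) :
    Integrable (fun y => heatKernel1 β y * exp (-l * y)) := by
  simp_rw [heat1_exp_sq hβ]
  exact ((integrable_of_int_one (heat1_one hβ)).comp_add_right _).const_mul _

lemma heat1_exp_val {β : ℝ} (hβ : 0 < β) (l : ℝ) :
    ∫ y, heatKernel1 β y * exp (-l * y) = exp (β * l ^ 2) := by
  simp_rw [heat1_exp_sq hβ]
  rw [integral_const_mul, integral_add_right_eq_self (heatKernel1 β), heat1_one hβ, mul_one]

lemma heat_kern (n : ℕ) {β : ℝ} (hβ : 0 < β) : Kern (heatKernel n β) := by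
  have := Kern.of_prod (n := n) (k := fun _ => heatKernel1 β) (fun _ => heat1_nonneg hβ)
    (fun _ => heat1_one hβ)
  convert this using 1
  ext y
  exact heat_eq_prod n hβ y

/-- bound for the heat kernel with exponential weight -/
lemma heat_exp_bound (n : ℕ) [NeZero n] {β : ℝ} (hβ : 0 < β) (l : ℝ) (y : Rn n) :
    heatKernel n β y * exp (-l * y 0) ≤ (4 * π * β) ^ (-(n : ℝ) / 2) * exp (β * l ^ 2) := by
  unfold heatKernel
  rw [mul_assoc, ← exp_add]
  apply mul_le_mul_of_nonneg_left _ (by positivity)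
  apply exp_le_exp.2
  have h1 : (y 0) ^ 2 ≤ ‖y‖ ^ 2 := by
    rw [EuclideanSpace.norm_sq_eq]
    have := Finset.single_le_sum (f := fun i => ‖y i‖ ^ 2) (fun i _ => by positivity)
      (Finset.mem_univ (0 : Fin n))
    simpa using this
  have h2 : -‖y‖ ^ 2 / (4 * β) ≤ - (y 0) ^ 2 / (4 * β) := by
    apply div_le_div_of_nonneg_right _ (by positivity)
    linarith
  have h3 : β * l ^ 2 - (- (y 0) ^ 2 / (4 * β) + -l * y 0) = (y 0 + 2 * β * l) ^ 2 / (4 * β) := by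
    field_simp; ring
  have : 0 ≤ (y 0 + 2 * β * l) ^ 2 / (4 * β) := by positivity
  linarith


lemma cv_cont {n : ℕ} {k : Rn n → ℝ} (hk : Kern k) {g : ℝ → Rn n → ℝ}
    (hg : Continuous (fun p : ℝ × Rn n => g p.1 p.2)) {M : ℝ} (hM : ∀ t y, |g t y| ≤ M) :
    Continuous (fun p : ℝ × Rn n => cv k (g p.1) p.2) := by
  unfold cv
  apply continuous_of_dominated (bound := fun y => k y * M)
  · intro p
    have h1 : Continuous (fun y => g p.1 (p.2 - y)) :=
      hg.comp (continuous_const.prodMk (continuous_const.sub continuous_id))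
    exact hk.int.aestronglyMeasurable.mul h1.aestronglyMeasurable
  · intro p
    refine Eventually.of_forall fun y => ?_
    rw [Real.norm_eq_abs, abs_mul, abs_of_nonneg (hk.nonneg y)]
    exact mul_le_mul_of_nonneg_left (hM _ _) (hk.nonneg y)
  · exact hk.int.mul_const M
  · refine Eventually.of_forall fun y => ?_
    exact continuous_const.mul
      (hg.comp (continuous_fst.prodMk (continuous_snd.sub continuous_const)))

lemma cv_diff {n : ℕ} {k : Rn n → ℝ} (hk : Kern k) {g1 g2 : Rn n → ℝ}
    (h1 : Measurable g1) (h2 : Measurable g2) {M A : ℝ}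
    (hM1 : ∀ y, |g1 y| ≤ M) (hM2 : ∀ y, |g2 y| ≤ M)
    (hA : ∀ y, |g1 y - g2 y| ≤ A) (x : Rn n) : |cv k g1 x - cv k g2 x| ≤ A := by
  unfold cv
  rw [← integral_sub (hk.cv_int h1 hM1 x) (hk.cv_int h2 hM2 x), ← Real.norm_eq_abs]
  refine (norm_integral_le_of_norm_le (hk.int.mul_const A) ?_).trans (hk.int_const A).le
  refine Eventually.of_forall fun y => ?_
  rw [← mul_sub, Real.norm_eq_abs, abs_mul, abs_of_nonneg (hk.nonneg y)]
  exact mul_le_mul_of_nonneg_left (hA _) (hk.nonneg y)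

lemma cv_mem {n : ℕ} {k : Rn n → ℝ} (hk : Kern k) {g : Rn n → ℝ}
    (h1 : Measurable g) {U : ℝ} (h : ∀ y, 0 ≤ g y ∧ g y ≤ U) (x : Rn n) :
    0 ≤ cv k g x ∧ cv k g x ≤ U := by
  unfold cv
  constructor
  · exact integral_nonneg fun y => mul_nonneg (hk.nonneg y) (h _).1
  · rw [← hk.int_const U]
    apply integral_mono (hk.cv_int h1 (M := U) (fun y => by rw [abs_of_nonneg (h y).1]; exact (h y).2) x)
      (hk.int.mul_const U)
    intro y
    exact mul_le_mul_of_nonneg_left (h _).2 (hk.nonneg y)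

section exist
variable {n : ℕ}

/-- right-hand side plus `K u` -/
noncomputable def Nop (J f : Rn n → ℝ) (d b : ℝ → ℝ) (τ D : ℝ) (u : ℝ → Rn n → ℝ)
    (s : ℝ) (x : Rn n) : ℝ :=
  cv J (u s) x + (D * u s x - d (u s x)) + cv f (fun y => b (u (s - τ) y)) x

/-- Picard map -/
noncomputable def Phi (J f : Rn n → ℝ) (d b : ℝ → ℝ) (τ D : ℝ) (h : ℝ → Rn n → ℝ)
    (u : ℝ → Rn n → ℝ) (t : ℝ) (x : Rn n) : ℝ :=
  exp (-((1 + D) * max t 0)) * (h (min t 0) x +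
    ∫ s in (0:ℝ)..(max t 0), exp ((1 + D) * s) * Nop J f d b τ D u s x)

/-- admissible functions -/
def Adm (h : ℝ → Rn n → ℝ) (U : ℝ) (u : ℝ → Rn n → ℝ) : Prop :=
  Continuous (fun p : ℝ × Rn n => u p.1 p.2) ∧ (∀ t x, 0 ≤ u t x ∧ u t x ≤ U) ∧
    ∀ t ≤ 0, ∀ x, u t x = h t x

lemma Adm.meas {h : ℝ → Rn n → ℝ} {U : ℝ} {u : ℝ → Rn n → ℝ} (hu : Adm h U u) (t : ℝ) :
    Continuous (u t) := hu.1.comp (continuous_const.prodMk continuous_id)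

lemma Adm.abs {h : ℝ → Rn n → ℝ} {U : ℝ} {u : ℝ → Rn n → ℝ} (hu : Adm h U u) (t : ℝ) (x : Rn n) :
    |u t x| ≤ U := by rw [abs_of_nonneg (hu.2.1 t x).1]; exact (hu.2.1 t x).2

variable {J f : Rn n → ℝ} {d b : ℝ → ℝ} {τ D b0 U : ℝ} {h : ℝ → Rn n → ℝ}

lemma b_bd (hbm : Monotone b) (hb0 : b 0 = 0) {v : ℝ} (hv : 0 ≤ v ∧ v ≤ U) :
    0 ≤ b v ∧ b v ≤ b U := ⟨hb0 ▸ hbm hv.1, hbm hv.2⟩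

lemma Nop_cont (hJ : Kern J) (hf : Kern f) (hdc : Continuous d) (hbc : Continuous b)
    (hbm : Monotone b) (hb0 : b 0 = 0) {u : ℝ → Rn n → ℝ} (hu : Adm h U u) :
    Continuous (fun p : ℝ × Rn n => Nop J f d b τ D u p.1 p.2) := by
  unfold Nop
  have h1 := cv_cont hJ hu.1 hu.abs
  have h2 : Continuous (fun p : ℝ × Rn n => b (u p.1 p.2)) := hbc.comp hu.1
  have h3 := cv_cont hf (g := fun t y => b (u t y)) h2 (M := b U) (fun t y => by
    have := b_bd hbm hb0 (hu.2.1 t y)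
    rw [abs_of_nonneg this.1]; exact this.2)
  have h4 : Continuous (fun p : ℝ × Rn n => cv f (fun y => b (u (p.1 - τ) y)) p.2) :=
    h3.comp ((continuous_fst.sub continuous_const).prodMk continuous_snd)
  exact (h1.add ((continuous_const.mul hu.1).sub (hdc.comp hu.1))).add h4

lemma Nop_cont_t (hJ : Kern J) (hf : Kern f) (hdc : Continuous d) (hbc : Continuous b)
    (hbm : Monotone b) (hb0 : b 0 = 0) {u : ℝ → Rn n → ℝ} (hu : Adm h U u) (x : Rn n) :
    Continuous (fun s : ℝ => Nop J f d b τ D u s x) :=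
  (Nop_cont hJ hf hdc hbc hbm hb0 hu).comp (continuous_id.prodMk continuous_const)

lemma Nop_mem (hJ : Kern J) (hf : Kern f) (hbc : Continuous b)
    (hbm : Monotone b) (hb0 : b 0 = 0) (hd0 : d 0 = 0) (hUU : d U = b U)
    (hdm : ∀ x y, x ≤ y → 0 ≤ d y - d x ∧ d y - d x ≤ D * (y - x))
    {u : ℝ → Rn n → ℝ} (hu : Adm h U u) (s : ℝ) (x : Rn n) :
    0 ≤ Nop J f d b τ D u s x ∧ Nop J f d b τ D u s x ≤ (1 + D) * U := by
  unfold Nop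
  have h1 := cv_mem hJ (hu.meas s).measurable (hu.2.1 s) x
  have h2 := cv_mem hf (g := fun y => b (u (s - τ) y)) (hbc.comp (hu.meas _)).measurable
    (fun y => b_bd hbm hb0 (hu.2.1 (s - τ) y)) x
  have h3 := hdm _ _ (hu.2.1 s x).1
  have h4 := hdm _ _ (hu.2.1 s x).2
  constructor <;> nlinarith [h1.1, h1.2, h2.1, h2.2, h3.1, h3.2, h4.1, h4.2]

lemma int_exp (k : ℝ) (t : ℝ) : ∫ s in (0:ℝ)..t, exp (k * s) * k = exp (k * t) - 1 := by
  have : ∀ s ∈ uIcc 0 t, HasDerivAt (fun s => exp (k * s)) (exp (k * s) * k) s := by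
    intro s _
    have h1 : HasDerivAt (fun s : ℝ => k * s) k s := by
      simpa using (hasDerivAt_id s).const_mul k
    exact h1.exp
  rw [intervalIntegral.integral_eq_sub_of_hasDerivAt this
    (Continuous.intervalIntegrable (by fun_prop) _ _)]
  simp

lemma Phi_adm (hJ : Kern J) (hf : Kern f) (hdc : Continuous d) (hbc : Continuous b)
    (hbm : Monotone b) (hb0 : b 0 = 0) (hd0 : d 0 = 0) (hUU : d U = b U)
    (hdm : ∀ x y, x ≤ y → 0 ≤ d y - d x ∧ d y - d x ≤ D * (y - x))
    (hhc : Continuous (fun p : ℝ × Rn n => h p.1 p.2)) (hhb : ∀ t x, 0 ≤ h t x ∧ h t x ≤ U)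
    {u : ℝ → Rn n → ℝ} (hu : Adm h U u) : Adm h U (Phi J f d b τ D h u) := by
  refine ⟨?_, ?_, ?_⟩
  · unfold Phi
    have hN : Continuous (fun q : (ℝ × Rn n) × ℝ =>
        exp ((1 + D) * q.2) * Nop J f d b τ D u q.2 q.1.2) := by
      have h0 := (Nop_cont (τ := τ) (D := D) hJ hf hdc hbc hbm hb0 hu).comp
        (continuous_snd.prodMk (continuous_snd.comp continuous_fst) :
          Continuous fun q : (ℝ × Rn n) × ℝ => (q.2, q.1.2))
      exact ((continuous_const.mul continuous_snd).rexp).mul h0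
    have hI : Continuous (fun p : ℝ × Rn n =>
        ∫ s in (0:ℝ)..(max p.1 0), exp ((1 + D) * s) * Nop J f d b τ D u s p.2) :=
      intervalIntegral.continuous_parametric_intervalIntegral_of_continuous
        (f := fun p s => exp ((1 + D) * s) * Nop J f d b τ D u s p.2) hN
        (continuous_fst.max continuous_const)
    have hh : Continuous (fun p : ℝ × Rn n => h (min p.1 0) p.2) :=
      hhc.comp ((continuous_fst.min continuous_const).prodMk continuous_snd)
    exact ((continuous_const.mul (continuous_fst.max continuous_const)).neg.rexp).mul (hh.add hI)
  · intro t x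
    unfold Phi
    set r := max t 0 with hr
    have hr0 : 0 ≤ r := le_max_right _ _
    have hc : Continuous (fun s => exp ((1 + D) * s) * Nop J f d b τ D u s x) :=
      (by fun_prop : Continuous fun s => exp ((1 + D) * s)).mul
        (Nop_cont_t hJ hf hdc hbc hbm hb0 hu x)
    have h1 : 0 ≤ ∫ s in (0:ℝ)..r, exp ((1 + D) * s) * Nop J f d b τ D u s x :=
      intervalIntegral.integral_nonneg hr0 fun s _ =>
        mul_nonneg (exp_pos _).le (Nop_mem hJ hf hbc hbm hb0 hd0 hUU hdm hu s x).1
    have h2 : ∫ s in (0:ℝ)..r, exp ((1 + D) * s) * Nop J f d b τ D u s x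
        ≤ (exp ((1 + D) * r) - 1) * U := by
      rw [← int_exp, ← intervalIntegral.integral_mul_const]
      apply intervalIntegral.integral_mono_on hr0 (hc.intervalIntegrable _ _)
        (Continuous.intervalIntegrable (by fun_prop) _ _)
      intro s _
      rw [mul_assoc]
      exact mul_le_mul_of_nonneg_left (Nop_mem hJ hf hbc hbm hb0 hd0 hUU hdm hu s x).2
        (exp_pos _).le
    have hh := hhb (min t 0) x
    constructor
    · exact mul_nonneg (exp_pos _).le (by linarith [hh.1])
    · calc _ ≤ exp (-((1 + D) * r)) * (U * exp ((1 + D) * r)) :=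
            mul_le_mul_of_nonneg_left (by linarith [hh.2]) (exp_pos _).le
        _ = U := by rw [mul_left_comm, ← exp_add]; simp
  · intro t ht x
    unfold Phi
    rw [max_eq_right ht, min_eq_left ht]
    simp

lemma Phi_contr (hJ : Kern J) (hf : Kern f) (hdc : Continuous d) (hbc : Continuous b)
    (hbm : Monotone b) (hb0 : b 0 = 0) (hD : 0 ≤ D) (hb0n : 0 ≤ b0) (hτ : 0 ≤ τ)
    (hdm : ∀ x y, |d y - d x| ≤ D * |y - x|)
    (hbL : ∀ x y, |b y - b x| ≤ b0 * |y - x|)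
    {u w : ℝ → Rn n → ℝ} (hu : Adm h U u) (hw : Adm h U w) {A : ℝ} (hA : 0 ≤ A)
    (huw : ∀ t x, |u t x - w t x| ≤ A * exp (2 * (1 + 2 * D + b0) * max t 0)) (t : ℝ) (x : Rn n) :
    |Phi J f d b τ D h u t x - Phi J f d b τ D h w t x| ≤
      (A / 2) * exp (2 * (1 + 2 * D + b0) * max t 0) := by
  unfold Phi
  set r := max t 0 with hr
  have hr0 : 0 ≤ r := le_max_right _ _
  set L := 2 * (1 + 2 * D + b0) with hL
  have hL0 : 0 < L := by positivity
  have hcu : Continuous (fun s => exp ((1 + D) * s) * Nop J f d b τ D u s x) :=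
    (by fun_prop : Continuous fun s => exp ((1 + D) * s)).mul
      (Nop_cont_t hJ hf hdc hbc hbm hb0 hu x)
  have hcw : Continuous (fun s => exp ((1 + D) * s) * Nop J f d b τ D w s x) :=
    (by fun_prop : Continuous fun s => exp ((1 + D) * s)).mul
      (Nop_cont_t hJ hf hdc hbc hbm hb0 hw x)
  rw [← mul_sub, add_sub_add_left_eq_sub, ← intervalIntegral.integral_sub
    (hcu.intervalIntegrable _ _) (hcw.intervalIntegrable _ _),
    ← intervalIntegral.integral_const_mul]
  have hN : ∀ s ∈ Icc 0 r, |Nop J f d b τ D u s x - Nop J f d b τ D w s x| ≤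
      (L / 2) * (A * exp (L * s)) := by
    intro s hs
    have hms : max s 0 = s := max_eq_left hs.1
    have h1 := cv_diff hJ (hu.meas s).measurable (hw.meas s).measurable (hu.abs s) (hw.abs s)
      (huw s) x
    have bb : ∀ {v : ℝ → Rn n → ℝ}, Adm h U v → ∀ y, |b (v (s - τ) y)| ≤ b U := fun hv y => by
      have := b_bd hbm hb0 (hv.2.1 (s - τ) y)
      rw [abs_of_nonneg this.1]; exact this.2
    have h2 := cv_diff hf (g1 := fun y => b (u (s - τ) y)) (g2 := fun y => b (w (s - τ) y))
      (hbc.comp (hu.meas _)).measurable (hbc.comp (hw.meas _)).measurable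
      (bb hu) (bb hw) (A := b0 * (A * exp (L * s))) (fun y => by
        refine (hbL _ _).trans (mul_le_mul_of_nonneg_left ?_ hb0n)
        refine (huw _ _).trans (mul_le_mul_of_nonneg_left ?_ hA)
        apply exp_le_exp.2
        apply mul_le_mul_of_nonneg_left _ hL0.le
        exact max_le (by linarith) hs.1) x
    have h3 := hdm (w s x) (u s x)
    have h4 := huw s x
    rw [hms] at h1 h4
    have h5 : |D * (u s x - w s x)| ≤ D * (A * exp (L * s)) := by
      rw [abs_mul, abs_of_nonneg hD]; exact mul_le_mul_of_nonneg_left h4 hD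
    have h6 : |d (u s x) - d (w s x)| ≤ D * (A * exp (L * s)) :=
      h3.trans (mul_le_mul_of_nonneg_left h4 hD)
    unfold Nop
    rw [abs_le] at *
    constructor <;> nlinarith [h1.1, h1.2, h2.1, h2.2, h5.1, h5.2, h6.1, h6.2]
  have hB : ∀ s ∈ Icc 0 r, ‖exp (-((1 + D) * r)) * (exp ((1 + D) * s) * Nop J f d b τ D u s x
      - exp ((1 + D) * s) * Nop J f d b τ D w s x)‖ ≤ (exp (L * s) * L) * (A / 2) := by
    intro s hs
    rw [← mul_sub, ← mul_assoc, ← exp_add, norm_mul, Real.norm_eq_abs, Real.norm_eq_abs,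
      abs_of_pos (exp_pos _)]
    have h1 : exp (-((1 + D) * r) + (1 + D) * s) ≤ 1 := by
      rw [exp_le_one_iff]; nlinarith [hs.2]
    calc _ ≤ 1 * |Nop J f d b τ D u s x - Nop J f d b τ D w s x| :=
          mul_le_mul_of_nonneg_right h1 (abs_nonneg _)
      _ ≤ (L / 2) * (A * exp (L * s)) := by rw [one_mul]; exact hN s hs
      _ = _ := by ring
  rw [← Real.norm_eq_abs]
  refine (intervalIntegral.norm_integral_le_of_norm_le hr0
    (g := fun s => (exp (L * s) * L) * (A / 2)) ?_ ?_).trans ?_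
  · exact Eventually.of_forall fun s hs => hB s ⟨hs.1.le, hs.2⟩
  · exact Continuous.intervalIntegrable (by fun_prop) _ _
  · rw [intervalIntegral.integral_mul_const, int_exp]
    nlinarith [exp_pos (L * r)]

lemma exists_sol (hJ : Kern J) (hf : Kern f) (hdc : Continuous d) (hbc : Continuous b)
    (hdmono : Monotone d)
    (hbm : Monotone b) (hb0 : b 0 = 0) (hd0 : d 0 = 0) (hUU : d U = b U)
    (hU : 0 ≤ U) (hD : 0 ≤ D) (hb0n : 0 ≤ b0) (hτ : 0 ≤ τ)
    (hdm : ∀ x y, |d y - d x| ≤ D * |y - x|)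
    (hbL : ∀ x y, |b y - b x| ≤ b0 * |y - x|)
    (hhc : Continuous (fun p : ℝ × Rn n => h p.1 p.2)) (hhb : ∀ t x, 0 ≤ h t x ∧ h t x ≤ U) :
    ∃ u : ℝ → Rn n → ℝ, Adm h U u ∧ (∀ x, Continuous fun t =>
        (cv J (u t) x - u t x - d (u t x) + cv f (fun y => b (u (t - τ) y)) x)) ∧
      ∀ t > 0, ∀ x, HasDerivAt (fun t => u t x)
        (cv J (u t) x - u t x - d (u t x) + cv f (fun y => b (u (t - τ) y)) x) t := by
  have hdm' : ∀ x y, x ≤ y → 0 ≤ d y - d x ∧ d y - d x ≤ D * (y - x) := by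
    intro x y hxy
    refine ⟨by linarith [hdmono hxy], ?_⟩
    have := hdm x y
    rw [abs_of_nonneg (sub_nonneg.2 hxy)] at this
    exact (le_abs_self _).trans this
  set P := Phi J f d b τ D h with hP
  set L := 2 * (1 + 2 * D + b0) with hL
  have hL0 : 0 < L := by positivity
  let us : ℕ → ℝ → Rn n → ℝ := fun k => P^[k] (fun t x => h (min t 0) x)
  have hus0 : us 0 = fun t x => h (min t 0) x := rfl
  have huss : ∀ k, us (k + 1) = P (us k) := fun k => Function.iterate_succ_apply' P k _
  have hadm : ∀ k, Adm h U (us k) := by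
    intro k
    induction k with
    | zero =>
      rw [hus0]
      refine ⟨hhc.comp ((continuous_fst.min continuous_const).prodMk continuous_snd),
        fun t x => hhb _ _, fun t ht x => by simp only [min_eq_left ht]⟩
    | succ k ih => rw [huss]; exact Phi_adm hJ hf hdc hbc hbm hb0 hd0 hUU hdm' hhc hhb ih
  have hstep : ∀ k t x, |us (k + 1) t x - us k t x| ≤ (U / 2 ^ k) * exp (L * max t 0) := by
    intro k
    induction k with
    | zero =>
      intro t x
      have h1 := (hadm 1).2.1 t x
      have h2 := (hadm 0).2.1 t x
      have h3 : 1 ≤ exp (L * max t 0) :=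
        one_le_exp (mul_nonneg hL0.le (le_max_right _ _))
      have h4 : |us (0 + 1) t x - us 0 t x| ≤ U := by
        rw [zero_add, abs_le]; constructor <;> linarith [h1.1, h1.2, h2.1, h2.2]
      refine h4.trans ?_
      simp only [pow_zero, div_one]
      exact le_mul_of_one_le_right hU h3
    | succ k ih =>
      intro t x
      have := Phi_contr (J := J) (f := f) (τ := τ) hJ hf hdc hbc hbm hb0 hD hb0n hτ hdm hbL
        (hadm (k + 1)) (hadm k) (A := U / 2 ^ k) (by positivity) ih t x
      rw [huss (k + 1)]
      nth_rewrite 2 [huss k]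
      refine this.trans (le_of_eq ?_)
      rw [pow_succ]; ring
  have hdist : ∀ t x k, dist (us k t x) (us (k + 1) t x) ≤ (2 * U * exp (L * max t 0)) / 2 / 2 ^ k := by
    intro t x k
    rw [dist_comm, Real.dist_eq]
    refine (hstep k t x).trans (le_of_eq ?_)
    ring
  have hlim : ∀ t x, ∃ l, Tendsto (fun k => us k t x) atTop (nhds l) := fun t x =>
    cauchySeq_tendsto_of_complete (cauchySeq_of_le_geometric_two (hdist t x))
  choose u hu using hlim
  have hrate : ∀ k t x, |us k t x - u t x| ≤ (2 * U / 2 ^ k) * exp (L * max t 0) := by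
    intro k t x
    have := dist_le_of_le_geometric_two_of_tendsto (hdist t x) (hu t x) k
    rw [Real.dist_eq] at this
    refine this.trans (le_of_eq ?_)
    ring
  have hz : ∀ B : ℝ, Tendsto (fun k : ℕ => (B / 2 ^ k)) atTop (nhds 0) := by
    intro B
    have h1 : Tendsto (fun k : ℕ => ((1:ℝ)/2) ^ k) atTop (nhds 0) :=
      tendsto_pow_atTop_nhds_zero_of_lt_one (by norm_num) (by norm_num)
    have h2 := h1.const_mul B
    rw [mul_zero] at h2
    refine h2.congr fun k => ?_
    rw [one_div, inv_pow]; field_simp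
  have huadm : Adm h U u := by
    refine ⟨?_, ?_, ?_⟩
    · have hloc : TendstoLocallyUniformly (fun k (p : ℝ × Rn n) => us k p.1 p.2)
          (fun p => u p.1 p.2) atTop := by
        rw [Metric.tendstoLocallyUniformly_iff]
        intro ε hε p
        refine ⟨{q | q.1 < p.1 + 1}, (isOpen_lt continuous_fst continuous_const).mem_nhds
          (by simp), ?_⟩
        have := (hz (2 * U * exp (L * max (p.1 + 1) 0)))
        filter_upwards [this.eventually (gt_mem_nhds hε)] with k hk q hq
        rw [dist_comm, Real.dist_eq]
        refine (hrate k q.1 q.2).trans_lt (lt_of_le_of_lt ?_ hk)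
        have : exp (L * max q.1 0) ≤ exp (L * max (p.1 + 1) 0) := by
          apply exp_le_exp.2
          apply mul_le_mul_of_nonneg_left _ hL0.le
          exact max_le_max hq.le le_rfl
        calc _ ≤ (2 * U / 2 ^ k) * exp (L * max (p.1 + 1) 0) :=
              mul_le_mul_of_nonneg_left this (by positivity)
          _ = _ := by ring
      exact hloc.continuous (Frequently.of_forall fun k => (hadm k).1)
    · intro t x
      exact ⟨ge_of_tendsto' (hu t x) fun k => ((hadm k).2.1 t x).1,
        le_of_tendsto' (hu t x) fun k => ((hadm k).2.1 t x).2⟩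
    · intro t ht x
      refine tendsto_nhds_unique (hu t x) ?_
      simp_rw [fun k => (hadm k).2.2 t ht x]
      exact tendsto_const_nhds
  have hfix : ∀ t x, P u t x = u t x := by
    intro t x
    have h1 : Tendsto (fun k => us (k + 1) t x) atTop (nhds (u t x)) :=
      (hu t x).comp (tendsto_add_atTop_nat 1)
    have h2 : Tendsto (fun k => us (k + 1) t x) atTop (nhds (P u t x)) := by
      rw [tendsto_iff_dist_tendsto_zero]
      refine squeeze_zero (fun _ => dist_nonneg) (fun k => ?_) (hz (U * exp (L * max t 0)))
      rw [Real.dist_eq, huss]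
      have := Phi_contr (J := J) (f := f) (τ := τ) hJ hf hdc hbc hbm hb0 hD hb0n hτ hdm hbL
        (hadm k) huadm (A := 2 * U / 2 ^ k) (by positivity) (hrate k) t x
      refine this.trans (le_of_eq ?_)
      ring
    exact tendsto_nhds_unique h2 h1
  have hrhs : ∀ t x, cv J (u t) x - u t x - d (u t x) + cv f (fun y => b (u (t - τ) y)) x =
      Nop J f d b τ D u t x - (1 + D) * u t x := by
    intro t x; unfold Nop; ring
  have hNt := fun x => Nop_cont_t (τ := τ) (D := D) hJ hf hdc hbc hbm hb0 huadm x
  refine ⟨u, huadm, ?_, ?_⟩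
  · intro x
    simp_rw [hrhs]
    exact (hNt x).sub (continuous_const.mul (huadm.1.comp (continuous_id.prodMk continuous_const)))
  · intro t ht x
    rw [hrhs]
    have hc : Continuous (fun s => exp ((1 + D) * s) * Nop J f d b τ D u s x) :=
      (by fun_prop : Continuous fun s => exp ((1 + D) * s)).mul (hNt x)
    have hder : HasDerivAt (fun t => exp (-((1 + D) * t)) * (h 0 x +
        ∫ s in (0:ℝ)..t, exp ((1 + D) * s) * Nop J f d b τ D u s x))
        ((exp (-((1 + D) * t)) * (-(1 + D))) * (h 0 x +
        ∫ s in (0:ℝ)..t, exp ((1 + D) * s) * Nop J f d b τ D u s x) +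
        exp (-((1 + D) * t)) * (exp ((1 + D) * t) * Nop J f d b τ D u t x)) t := by
      have h1 : HasDerivAt (fun t : ℝ => -((1 + D) * t)) (-(1 + D)) t := by
        have := ((hasDerivAt_id t).const_mul (1 + D)).neg
        rw [mul_one] at this
        exact this
      exact h1.exp.mul ((hc.integral_hasStrictDerivAt 0 t).hasDerivAt.const_add _)
    have heq : ∀ s > 0, u s x = exp (-((1 + D) * s)) * (h 0 x +
        ∫ r in (0:ℝ)..s, exp ((1 + D) * r) * Nop J f d b τ D u r x) := by
      intro s hs
      rw [← hfix s x, hP]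
      unfold Phi
      rw [max_eq_left hs.le, min_eq_right hs.le]
    have hval : (exp (-((1 + D) * t)) * (-(1 + D))) * (h 0 x +
        ∫ s in (0:ℝ)..t, exp ((1 + D) * s) * Nop J f d b τ D u s x) +
        exp (-((1 + D) * t)) * (exp ((1 + D) * t) * Nop J f d b τ D u t x) =
        Nop J f d b τ D u t x - (1 + D) * u t x := by
      rw [heq t ht, ← mul_assoc (exp _) (exp _), ← exp_add]
      simp; ring
    rw [hval] at hder
    refine hder.congr_of_eventuallyEq ?_
    filter_upwards [lt_mem_nhds ht] with s hs
    exact heq s hs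

end exist


/-- solution facts -/
structure SolF {n : ℕ} (J f : Rn n → ℝ) (d b : ℝ → ℝ) (τ U : ℝ) (u : ℝ → Rn n → ℝ) : Prop where
  cont : ContinuousOn (fun p : ℝ × Rn n => u p.1 p.2) (Set.Ici (-τ) ×ˢ Set.univ)
  mem : ∀ t ≥ -τ, ∀ x, u t x ∈ Icc 0 U
  der : ∀ t > 0, ∀ x, HasDerivAt (fun t => u t x)
    (cv J (u t) x - u t x - d (u t x) + cv f (fun y => b (u (t - τ) y)) x) t

/-- nonlinearity facts -/
structure NL (d b : ℝ → ℝ) (U d0 D b0 : ℝ) : Prop where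
  dlo : ∀ x ∈ Icc 0 U, ∀ y ∈ Icc 0 U, x ≤ y → d0 * (y - x) ≤ d y - d x
  dhi : ∀ x ∈ Icc 0 U, ∀ y ∈ Icc 0 U, x ≤ y → d y - d x ≤ D * (y - x)
  blo : ∀ x ∈ Icc 0 U, ∀ y ∈ Icc 0 U, x ≤ y → 0 ≤ b y - b x
  bhi : ∀ x ∈ Icc 0 U, ∀ y ∈ Icc 0 U, x ≤ y → b y - b x ≤ b0 * (y - x)
  d0nn : 0 ≤ d0
  Dnn : 0 ≤ D
  b0nn : 0 ≤ b0
  bcont : ContinuousOn b (Icc 0 U)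
  bz : b 0 = 0
  dz : d 0 = 0
  eqU : d U = b U

section nl
variable {d b : ℝ → ℝ} {U d0 D b0 : ℝ}

lemma NL.dabs (h : NL d b U d0 D b0) {x y : ℝ} (hx : x ∈ Icc 0 U) (hy : y ∈ Icc 0 U) :
    d0 * |x - y| ≤ |d x - d y| := by
  rcases le_total x y with hxy | hxy
  · rw [abs_sub_comm x, abs_sub_comm (d x), abs_of_nonneg (sub_nonneg.2 hxy)]
    exact (h.dlo x hx y hy hxy).trans (le_abs_self _)
  · rw [abs_of_nonneg (sub_nonneg.2 hxy)]
    exact (h.dlo y hy x hx hxy).trans (le_abs_self _)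

lemma NL.babs (h : NL d b U d0 D b0) {x y : ℝ} (hx : x ∈ Icc 0 U) (hy : y ∈ Icc 0 U) :
    |b x - b y| ≤ b0 * |x - y| := by
  rcases le_total x y with hxy | hxy
  · rw [abs_sub_comm x, abs_sub_comm (b x), abs_of_nonneg (sub_nonneg.2 hxy),
      abs_of_nonneg (h.blo x hx y hy hxy)]
    exact h.bhi x hx y hy hxy
  · rw [abs_of_nonneg (sub_nonneg.2 hxy), abs_of_nonneg (h.blo y hy x hx hxy)]
    exact h.bhi y hy x hx hxy

lemma NL.bmem (h : NL d b U d0 D b0) {x : ℝ} (hx : x ∈ Icc 0 U) : b x ∈ Icc 0 (b U) := by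
  have hU : 0 ≤ U := hx.1.trans hx.2
  have h1 := h.blo 0 ⟨le_rfl, hU⟩ x hx hx.1
  have h2 := h.blo x hx U ⟨hU, le_rfl⟩ hx.2
  rw [h.bz] at h1
  exact ⟨by linarith, by linarith⟩

lemma NL.dabs_eq (h : NL d b U d0 D b0) {x y : ℝ} (hx : x ∈ Icc 0 U) (hy : y ∈ Icc 0 U)
    (hxy : x ≤ y) : |d y - d x| = d y - d x := by
  apply abs_of_nonneg
  exact (mul_nonneg h.d0nn (sub_nonneg.2 hxy)).trans (h.dlo x hx y hy hxy)
end nl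

section sol
variable {n : ℕ} {J f : Rn n → ℝ} {d b : ℝ → ℝ} {τ U d0 D b0 : ℝ} {u w : ℝ → Rn n → ℝ}

lemma SolF.cx (h : SolF J f d b τ U u) {t : ℝ} (ht : -τ ≤ t) : Continuous (u t) := by
  have h1 := h.cont.comp (f := fun x : Rn n => (t, x)) (s := univ)
    (continuous_const.prodMk continuous_id).continuousOn (fun x _ => ⟨ht, mem_univ _⟩)
  exact continuousOn_univ.1 h1

lemma SolF.ct (h : SolF J f d b τ U u) (x : Rn n) :
    ContinuousOn (fun t => u t x) (Ici (-τ)) :=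
  h.cont.comp (f := fun t : ℝ => (t, x)) (s := Ici (-τ))
    (continuous_id.prodMk continuous_const).continuousOn (fun t ht => ⟨ht, mem_univ _⟩)

lemma SolF.cb (h : SolF J f d b τ U u) (hn : NL d b U d0 D b0) {t : ℝ} (ht : -τ ≤ t) :
    Continuous (fun y => b (u t y)) :=
  hn.bcont.comp_continuous (h.cx ht) fun y => h.mem t ht y

lemma SolF.uabs (h : SolF J f d b τ U u) {t : ℝ} (ht : -τ ≤ t) (y : Rn n) : |u t y| ≤ U := by
  rw [abs_of_nonneg (h.mem t ht y).1]; exact (h.mem t ht y).2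

lemma SolF.babs (h : SolF J f d b τ U u) (hn : NL d b U d0 D b0) {t : ℝ} (ht : -τ ≤ t) (y : Rn n) :
    |b (u t y)| ≤ b U := by
  have := hn.bmem (h.mem t ht y)
  rw [abs_of_nonneg this.1]; exact this.2

lemma cv_sub_le {k : Rn n → ℝ} (hk : Kern k) {g1 g2 : Rn n → ℝ}
    (h1 : Measurable g1) (h2 : Measurable g2) {M : ℝ}
    (hM1 : ∀ y, |g1 y| ≤ M) (hM2 : ∀ y, |g2 y| ≤ M) (x : Rn n) :
    |cv k g1 x - cv k g2 x| ≤ cv k (fun y => |g1 y - g2 y|) x := by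
  unfold cv
  rw [← integral_sub (hk.cv_int h1 hM1 x) (hk.cv_int h2 hM2 x), ← Real.norm_eq_abs]
  refine norm_integral_le_of_norm_le ?_ ?_
  · refine hk.cv_int (g := fun y => |g1 y - g2 y|) (M := M + M) (h1.sub h2).abs (fun y => ?_) x
    rw [abs_abs]
    exact (abs_sub _ _).trans (add_le_add (hM1 y) (hM2 y))
  · refine Eventually.of_forall fun y => ?_
    rw [← mul_sub, Real.norm_eq_abs, abs_mul, abs_of_nonneg (hk.nonneg y)]

lemma diff_der (hJ : Kern J) (hf : Kern f) (hn : NL d b U d0 D b0) (hτ : 0 < τ)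
    (hu : SolF J f d b τ U u) (hw : SolF J f d b τ U w) {t : ℝ} (ht : 0 < t) (x : Rn n)
    (hne : 0 < |u t x - w t x|) :
    ∃ q', HasDerivAt (fun t => |u t x - w t x|) q' t ∧
      q' ≤ cv J (fun y => |u t y - w t y|) x - |u t x - w t x| - |d (u t x) - d (w t x)|
        + cv f (fun y => |b (u (t - τ) y) - b (w (t - τ) y)|) x := by
  have ht1 : -τ ≤ t := by linarith
  have ht2 : -τ ≤ t - τ := by linarith
  have h1 := hu.der t ht x
  have h2 := hw.der t ht x
  have h12 := h1.sub h2
  have hJd := cv_sub_le hJ (hu.cx ht1).measurable (hw.cx ht1).measurable (hu.uabs ht1)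
    (hw.uabs ht1) x
  have hfd := cv_sub_le hf (hu.cb hn ht2).measurable (hw.cb hn ht2).measurable (hu.babs hn ht2)
    (hw.babs hn ht2) x
  rw [abs_le] at hJd hfd
  have hmu := hu.mem t ht1 x
  have hmw := hw.mem t ht1 x
  have hcont := h12.continuousAt
  rcases lt_or_gt_of_ne (abs_pos.1 hne) with hlt | hgt
  · have hev : (fun t => |u t x - w t x|) =ᶠ[nhds t] fun t => -(u t x - w t x) := by
      filter_upwards [hcont.eventually (gt_mem_nhds hlt)] with s hs
      exact abs_of_neg hs
    refine ⟨_, h12.neg.congr_of_eventuallyEq hev, ?_⟩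
    rw [abs_of_neg hlt, abs_sub_comm (d _), hn.dabs_eq hmu hmw (by linarith)]
    linarith [hJd.1, hJd.2, hfd.1, hfd.2]
  · have hev : (fun t => |u t x - w t x|) =ᶠ[nhds t] fun t => (u t x - w t x) := by
      filter_upwards [hcont.eventually (lt_mem_nhds hgt)] with s hs
      exact abs_of_pos hs
    refine ⟨_, h12.congr_of_eventuallyEq hev, ?_⟩
    rw [abs_of_pos hgt, hn.dabs_eq hmw hmu (by linarith)]
    linarith [hJd.1, hJd.2, hfd.1, hfd.2]

lemma SolF.dct (hu : SolF J f d b τ U u) (hw : SolF J f d b τ U w) (x : Rn n) :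
    ContinuousOn (fun t => |u t x - w t x|) (Ici (-τ)) := ((hu.ct x).sub (hw.ct x)).abs

lemma SolF.dU (hu : SolF J f d b τ U u) (hw : SolF J f d b τ U w) {t : ℝ} (ht : -τ ≤ t) (x : Rn n) :
    |u t x - w t x| ≤ U := by
  have h1 := hu.mem t ht x
  have h2 := hw.mem t ht x
  rw [abs_le]; constructor <;> linarith [h1.1, h1.2, h2.1, h2.2]

lemma sol_unique (hJ : Kern J) (hf : Kern f) (hn : NL d b U d0 D b0) (hτ : 0 < τ)
    (hu : SolF J f d b τ U u) (hw : SolF J f d b τ U w)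
    (h0 : ∀ s ∈ Icc (-τ) 0, ∀ x, u s x = w s x) : ∀ t ≥ -τ, ∀ x, u t x = w t x := by
  intro t ht x
  rcases le_or_gt t 0 with ht0 | ht0
  · exact h0 t ⟨ht, ht0⟩ x
  have hb := hn.b0nn
  have key := cmp_lemma (fun t x => |u t x - w t x|) 0 t (1 + b0) U (by positivity)
    (fun s hs x => hu.dU hw (by linarith [hs.1]) x) ?_ t ⟨ht0.le, le_rfl⟩ x
  · have := abs_nonpos_iff.1 key
    linarith
  intro S hS hbd r hr y hpos
  refine ⟨0, le_rfl, hr.1, by simp [h0 0 ⟨by linarith, le_rfl⟩ y],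
    (hu.dct hw y).mono (fun s hs => by simp only [mem_Ici]; linarith [hs.1]), ?_⟩
  intro s hs hsp
  obtain ⟨q', hq', hle⟩ := diff_der hJ hf hn hτ hu hw hs.1 y hsp
  refine ⟨q', hq', hle.trans ?_⟩
  have hs1 : -τ ≤ s := by linarith [hs.1]
  have hs2 : -τ ≤ s - τ := by linarith [hs.1]
  have h1 := (cv_mem hJ (g := fun y => |u s y - w s y|)
    ((hu.cx hs1).sub (hw.cx hs1)).abs.measurable
    (fun z => ⟨abs_nonneg _, hbd s ⟨hs.1.le, hs.2.le.trans hr.2⟩ z⟩) y).2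
  have h2 := (cv_mem hf (g := fun y => |b (u (s - τ) y) - b (w (s - τ) y)|)
    ((hu.cb hn hs2).sub (hw.cb hn hs2)).abs.measurable (U := b0 * (S * exp (2 * (1 + b0) * s)))
    (fun z => ⟨abs_nonneg _, by
      refine (hn.babs (hu.mem _ hs2 z) (hw.mem _ hs2 z)).trans (mul_le_mul_of_nonneg_left ?_ hb)
      rcases le_or_gt (s - τ) 0 with hc | hc
      · rw [h0 _ ⟨hs2, hc⟩ z]; simp; positivity
      · refine (hbd (s - τ) ⟨hc.le, by linarith [hs.2, hr.2]⟩ z).trans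
          (mul_le_mul_of_nonneg_left (exp_le_exp.2 ?_) hS)
        apply mul_le_mul_of_nonneg_left _ (by positivity)
        linarith⟩) y).2
  have h3 := abs_nonneg (d (u s y) - d (w s y))
  linarith

lemma cv_le_bar [NeZero n] {k : Rn n → ℝ} (hk : Kern k) {l : ℝ}
    (hkl : Integrable (fun y : Rn n => k y * exp (-l * y 0)))
    {g q : Rn n → ℝ} {M1 M : ℝ} (hg : Measurable g) (hgM : ∀ y, |g y| ≤ M1)
    (hq : Measurable q) (hqM : ∀ y, |q y| ≤ M) {A E S : ℝ}
    (hle : ∀ y, g y ≤ A * q y + E * exp (l * y 0) + S) (x : Rn n) :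
    cv k g x ≤ A * cv k q x + E * exp (l * x 0) * (∫ y : Rn n, k y * exp (-l * y 0)) + S := by
  have i1 := (hk.cv_int hq hqM x).const_mul A
  have i2 := hkl.const_mul (E * exp (l * x 0))
  have i3 := hk.int.mul_const S
  have i12 : Integrable (fun y => A * (k y * q (x - y)) +
    E * exp (l * x 0) * (k y * exp (-l * y 0))) := i1.add i2
  have i123 : Integrable (fun y => (A * (k y * q (x - y)) +
    E * exp (l * x 0) * (k y * exp (-l * y 0))) + k y * S) := i12.add i3
  have : A * cv k q x + E * exp (l * x 0) * (∫ y : Rn n, k y * exp (-l * y 0)) + S =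
      ∫ y, ((A * (k y * q (x - y)) + E * exp (l * x 0) * (k y * exp (-l * y 0))) + k y * S) := by
    rw [integral_add i12 i3, hk.int_const, integral_add i1 i2, integral_const_mul,
      integral_const_mul]
    rfl
  rw [this]
  unfold cv
  apply integral_mono (hk.cv_int hg hgM x) i123
  intro y
  have h1 := mul_le_mul_of_nonneg_left (hle (x - y)) (hk.nonneg y)
  refine h1.trans (le_of_eq ?_)
  have h2 : exp (l * (x - y) 0) = exp (l * x 0) * exp (-l * y 0) := by
    rw [← exp_add]; congr 1; simp; ring
  simp only [h2, Pi.add_apply]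
  ring

set_option maxHeartbeats 1000000 in
lemma stage1 [NeZero n] (hJ : Kern J) (hf : Kern f) (hn : NL d b U d0 D b0) (hτ : 0 < τ)
    (hu : SolF J f d b τ U u) (hw : SolF J f d b τ U w) {l c μ γ M C1 : ℝ} {q : Rn n → ℝ}
    (hl : 0 < l) (hc : 0 < c)
    (hJl : Integrable (fun y : Rn n => J y * exp (-l * y 0)))
    (hfl : Integrable (fun y : Rn n => f y * exp (-l * y 0)))
    (hq : Measurable q) (hq0 : ∀ x, 0 ≤ q x) (hqM : ∀ x, q x ≤ M) (hC1 : 0 ≤ C1)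
    (hqi : ∀ s ∈ Icc (-τ) 0, ∀ x, |u s x - w s x| ≤ q x)
    (hqJ : ∀ x, cv J q x ≤ q x / 2 + C1 * exp (l * x 0))
    (hqf : ∀ x, cv f q x ≤ C1 * exp (l * x 0))
    (hγ : 0 < γ) (hμ1 : μ ≤ 1 / 2)
    (hgap : (∫ y : Rn n, J y * exp (-l * y 0)) +
      b0 * (∫ y : Rn n, f y * exp (-l * y 0)) * exp (-l * c * τ + μ * τ)
      - 1 - d0 + μ - l * c ≤ -γ) :
    ∃ K ≥ 0, ∀ t ≥ 0, ∀ x, |u t x - w t x| ≤ M * exp (-t / 2) + K * exp (l * (x 0 + c * t) - μ * t) := by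
  have hb := hn.b0nn
  set C2 := C1 + b0 * exp (τ / 2) * C1 with hC2
  have hC2n : 0 ≤ C2 := by positivity
  set K := C2 / γ with hK
  have hKn : 0 ≤ K := by positivity
  have hKγ : γ * K = C2 := by rw [hK]; field_simp
  refine ⟨K, hKn, ?_⟩
  set E : ℝ → Rn n → ℝ := fun t x => K * exp (l * (x 0 + c * t) - μ * t) with hE
  have hEn : ∀ t x, 0 ≤ E t x := fun t x => by positivity
  set V : ℝ → Rn n → ℝ := fun t x => exp (-t / 2) * q x + E t x with hV
  have hVn : ∀ t x, 0 ≤ V t x := fun t x => add_nonneg (mul_nonneg (exp_pos _).le (hq0 x)) (hEn t x)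
  have hqa : ∀ y, |q y| ≤ M := fun y => by rw [abs_of_nonneg (hq0 y)]; exact hqM y
  have hneg : ∀ s ∈ Icc (-τ) 0, ∀ x, |u s x - w s x| ≤ V s x := by
    intro s hs x
    have h1 : 1 ≤ exp (-s / 2) := one_le_exp (by linarith [hs.2])
    have h2 := le_mul_of_one_le_left (hq0 x) h1
    have h3 := hqi s hs x
    have h4 := hEn s x
    simp only [hV]; linarith
  have hEder : ∀ t x, HasDerivAt (fun t => E t x) (E t x * (l * c - μ)) t := by
    intro t x
    have h1 : HasDerivAt (fun t : ℝ => l * (x 0 + c * t) - μ * t) (l * c - μ) t := by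
      have h2 := ((((hasDerivAt_id t).const_mul c).const_add (x 0)).const_mul l).sub
        ((hasDerivAt_id t).const_mul μ)
      simp only [mul_one] at h2
      exact h2
    have h3 := h1.exp.const_mul K
    rw [← mul_assoc] at h3
    exact h3
  have hVder : ∀ t x, HasDerivAt (fun t => V t x)
      (exp (-t / 2) * (-1 / 2) * q x + E t x * (l * c - μ)) t := by
    intro t x
    have h1 : HasDerivAt (fun t : ℝ => -t / 2) (-1 / 2) t := ((hasDerivAt_id t).neg).div_const 2
    exact (h1.exp.mul_const (q x)).add (hEder t x)
  intro t ht x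
  have key := cmp_lemma (fun t x => |u t x - w t x| - V t x) 0 t (1 + b0) U (by positivity)
    (fun s hs x => by linarith [hu.dU hw (by linarith [hs.1] : -τ ≤ s) x, hVn s x])
    ?_ t ⟨ht, le_rfl⟩ x
  · have h1 : exp (-t / 2) * q x ≤ M * exp (-t / 2) := by
      rw [mul_comm]; exact mul_le_mul_of_nonneg_right (hqM x) (exp_pos _).le
    simp only [hV, hE] at key
    linarith
  intro S hS hbd r hr y hpos
  refine ⟨0, le_rfl, hr.1, by linarith [hneg 0 ⟨by linarith, le_rfl⟩ y],
    ((hu.dct hw y).mono (fun s hs => by simp only [mem_Ici]; linarith [hs.1])).sub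
      (fun s _ => (hVder s y).continuousAt.continuousWithinAt), ?_⟩
  intro s hs hsp
  have hvpos : 0 < |u s y - w s y| := by linarith [hVn s y]
  obtain ⟨q', hq', hle⟩ := diff_der hJ hf hn hτ hu hw hs.1 y hvpos
  refine ⟨_, hq'.sub (hVder s y), ?_⟩
  have hs1 : -τ ≤ s := by linarith [hs.1]
  have hs2 : -τ ≤ s - τ := by linarith [hs.1]
  set S' := S * exp (2 * (1 + b0) * s) with hS'
  have hS'n : 0 ≤ S' := by positivity
  have hall : ∀ z, |u s z - w s z| ≤ V s z + S' := fun z => by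
    linarith [hbd s ⟨hs.1.le, hs.2.le.trans hr.2⟩ z]
  have hall2 : ∀ z, |u (s - τ) z - w (s - τ) z| ≤ V (s - τ) z + S' := fun z => by
    rcases le_or_gt (s - τ) 0 with hc0 | hc0
    · linarith [hneg (s - τ) ⟨hs2, hc0⟩ z]
    · have h1 := hbd (s - τ) ⟨hc0.le, by linarith [hs.2, hr.2]⟩ z
      have h2 : S * exp (2 * (1 + b0) * (s - τ)) ≤ S' := by
        refine mul_le_mul_of_nonneg_left (exp_le_exp.2 ?_) hS
        apply mul_le_mul_of_nonneg_left _ (by positivity)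
        linarith
      linarith
  have hEsplit : ∀ t (z : Rn n), E t z = (K * exp (l * c * t - μ * t)) * exp (l * z 0) := by
    intro t z
    simp only [hE]
    rw [mul_assoc, ← exp_add]; congr 2; ring
  have h1 := cv_le_bar hJ hJl (g := fun y => |u s y - w s y|)
    ((hu.cx hs1).sub (hw.cx hs1)).abs.measurable (M1 := U)
    (fun z => by rw [abs_abs]; exact hu.dU hw hs1 z) hq hqa (A := exp (-s / 2))
    (E := K * exp (l * c * s - μ * s)) (S := S')
    (fun z => by rw [← hEsplit]; exact hall z) y
  have h2 := cv_le_bar hf hfl (g := fun y => |b (u (s - τ) y) - b (w (s - τ) y)|)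
    ((hu.cb hn hs2).sub (hw.cb hn hs2)).abs.measurable (M1 := b0 * U)
    (fun z => by
      rw [abs_abs]
      exact (hn.babs (hu.mem _ hs2 z) (hw.mem _ hs2 z)).trans
        (mul_le_mul_of_nonneg_left (hu.dU hw hs2 z) hb)) hq hqa (A := b0 * exp (-(s - τ) / 2))
    (E := b0 * (K * exp (l * c * (s - τ) - μ * (s - τ)))) (S := b0 * S')
    (fun z => by
      refine (hn.babs (hu.mem _ hs2 z) (hw.mem _ hs2 z)).trans
        ((mul_le_mul_of_nonneg_left (hall2 z) hb).trans (le_of_eq ?_))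
      simp only [hV]
      rw [hEsplit]; ring) y
  rw [← hEsplit] at h1
  have hEs2 : b0 * (K * exp (l * c * (s - τ) - μ * (s - τ))) * exp (l * y 0) =
      b0 * (E s y * exp (-l * c * τ + μ * τ)) := by
    rw [hEsplit, mul_assoc b0, mul_assoc K, mul_assoc K, mul_assoc K, ← exp_add, ← exp_add,
      ← exp_add]
    congr 3; ring
  rw [hEs2] at h2
  have h3 := hn.dabs (hu.mem s hs1 y) (hw.mem s hs1 y)
  have hv : V s y ≤ |u s y - w s y| := by linarith
  have h4 : (1 + d0) * V s y ≤ |u s y - w s y| + |d (u s y) - d (w s y)| := by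
    nlinarith [mul_le_mul_of_nonneg_left hv hn.d0nn]
  have h5 := mul_le_mul_of_nonneg_left (hqJ y) (exp_pos (-s / 2)).le
  have h6 : b0 * exp (-(s - τ) / 2) * cv f q y ≤ b0 * exp (-(s - τ) / 2) * (C1 * exp (l * y 0)) :=
    mul_le_mul_of_nonneg_left (hqf y) (by positivity)
  have h7 : exp (-(s - τ) / 2) = exp (τ / 2) * exp (-s / 2) := by
    rw [← exp_add]; congr 1; ring
  rw [h7] at h6 h2
  have h8 : C2 * (exp (-s / 2) * exp (l * y 0)) ≤ γ * E s y := by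
    rw [hEsplit, ← mul_assoc, ← mul_assoc, ← mul_assoc, hKγ]
    apply mul_le_mul_of_nonneg_right _ (exp_pos _).le
    apply mul_le_mul_of_nonneg_left _ hC2n
    apply exp_le_exp.2
    nlinarith [mul_pos (mul_pos hl hc) hs.1, hs.1]
  have h9 := mul_le_mul_of_nonneg_right hgap (hEn s y)
  have h10 : 0 ≤ d0 * (exp (-s / 2) * q y) := mul_nonneg hn.d0nn (mul_nonneg (exp_pos _).le (hq0 y))
  simp only [hV] at h4
  have h11 : q' ≤ cv J (fun y => |u s y - w s y|) y - (1 + d0) * (exp (-s / 2) * q y + E s y)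
      + cv f (fun y => |b (u (s - τ) y) - b (w (s - τ) y)|) y := by linarith
  have h12 : C2 * (exp (-s / 2) * exp (l * y 0)) = exp (-s / 2) * (C1 * exp (l * y 0)) +
      b0 * (exp (τ / 2) * exp (-s / 2)) * (C1 * exp (l * y 0)) := by rw [hC2]; ring
  linarith
end sol

section qlem
variable {n : ℕ} [NeZero n]

lemma cv_le_of_lint {k : Rn n → ℝ} (hk0 : ∀ y, 0 ≤ k y) (hkm : Measurable k)
    {Q : Rn n → ENNReal} (hQm : Measurable Q) (hQ : ∀ x, Q x ≠ ⊤) {B : ℝ} (hB : 0 ≤ B) (x : Rn n)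
    (h : ∫⁻ y, ENNReal.ofReal (k y) * Q (x - y) ≤ ENNReal.ofReal B) :
    cv k (fun y => (Q y).toReal) x ≤ B := by
  unfold cv
  rw [integral_eq_lintegral_of_nonneg_ae]
  · refine ENNReal.toReal_le_of_le_ofReal hB (le_trans (le_of_eq ?_) h)
    apply lintegral_congr
    intro y
    rw [ENNReal.ofReal_mul (hk0 y), ENNReal.ofReal_toReal (hQ _)]
  · exact Eventually.of_forall fun y => mul_nonneg (hk0 y) ENNReal.toReal_nonneg
  · exact (hkm.mul (hQm.comp (measurable_const.sub measurable_id)).ennreal_toReal).aestronglyMeasurable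

lemma exp_meas (l : ℝ) : Measurable (fun y : Rn n => exp (l * y 0)) := by
  have : Continuous (fun y : Rn n => exp (l * y 0)) := by fun_prop
  exact this.measurable

/-- convolution with an exponentially bounded kernel -/
lemma lint_exp_conv (l : ℝ) {Q : Rn n → ENNReal} (x : Rn n) :
    ∫⁻ y : Rn n, ENNReal.ofReal (exp (l * y 0)) * Q (x - y) =
      ENNReal.ofReal (exp (l * x 0)) * ∫⁻ z : Rn n, ENNReal.ofReal (exp (-l * z 0)) * Q z := by
  rw [← lintegral_sub_left_eq_self (fun z : Rn n => ENNReal.ofReal (exp (-l * z 0)) * Q z) x,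
    ← lintegral_const_mul' _ _ ENNReal.ofReal_ne_top]
  apply lintegral_congr
  intro y
  rw [← mul_assoc, ← ENNReal.ofReal_mul (exp_pos _).le, ← exp_add]
  congr 3
  simp
  ring

lemma choose_N {J : Rn n → ℝ} {l : ℝ} (hJ : Kern J) (hJm : Measurable J)
    (hJl : Integrable (fun y : Rn n => J y * exp (-l * y 0))) :
    ∃ N : ℝ, 0 ≤ N ∧ ∫⁻ y : Rn n, ENNReal.ofReal (J y - N * exp (l * y 0)) *
      ENNReal.ofReal (1 + exp (-l * y 0)) ≤ 1 / 8 := by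
  have hlim : Tendsto (fun N : ℕ => ∫⁻ y : Rn n, ENNReal.ofReal (J y - N * exp (l * y 0)) *
      ENNReal.ofReal (1 + exp (-l * y 0))) atTop (nhds (∫⁻ _ : Rn n, 0)) := by
    refine tendsto_lintegral_of_dominated_convergence
      (fun y => ENNReal.ofReal (J y * (1 + exp (-l * y 0)))) ?_ ?_ ?_ ?_
    · intro N
      exact (hJm.sub ((exp_meas l).const_mul _)).ennreal_ofReal.mul
        ((exp_meas (-l)).const_add 1).ennreal_ofReal
    · intro N
      refine Eventually.of_forall fun y => ?_
      show ENNReal.ofReal (J y - N * exp (l * y 0)) *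
        ENNReal.ofReal (1 + exp (-l * y 0)) ≤ ENNReal.ofReal (J y * (1 + exp (-l * y 0)))
      rw [ENNReal.ofReal_mul (hJ.nonneg y)]
      gcongr
      have : 0 ≤ (N : ℝ) * exp (l * y 0) := by positivity
      linarith
    · have h1 : Integrable (fun y : Rn n => J y * (1 + exp (-l * y 0))) := by
        simp only [mul_add, mul_one]
        exact hJ.int.add hJl
      exact (h1.lintegral_lt_top).ne
    · refine Eventually.of_forall fun y => ?_
      apply tendsto_const_nhds.congr'
      obtain ⟨N0, hN0⟩ := exists_nat_ge (J y / exp (l * y 0))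
      filter_upwards [eventually_ge_atTop N0] with N hN
      rw [ENNReal.ofReal_of_nonpos, zero_mul]
      rw [div_le_iff₀ (exp_pos _)] at hN0
      have : (N0 : ℝ) * exp (l * y 0) ≤ N * exp (l * y 0) := by gcongr
      linarith
  simp only [lintegral_zero] at hlim
  have h8 : (0 : ENNReal) < 1 / 8 := by simp
  obtain ⟨N, hN⟩ := (hlim.eventually (gt_mem_nhds h8)).exists
  exact ⟨N, Nat.cast_nonneg _, hN.le⟩

lemma q_exists {J f G : Rn n → ℝ} {l F U : ℝ} (hJ : Kern J) (hJm : Measurable J)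
    (hf : Kern f) (hfm : Measurable f) (hF : 0 ≤ F)
    (hJl : Integrable (fun y : Rn n => J y * exp (-l * y 0)))
    (hfl : ∀ y : Rn n, f y * exp (-l * y 0) ≤ F)
    (hGm : Measurable G) (hG0 : ∀ x, 0 ≤ G x) (hGU : ∀ x, G x ≤ U)
    (hGl : Integrable (fun y : Rn n => exp (-l * y 0) * G y)) :
    ∃ (q : Rn n → ℝ) (M C1 : ℝ), Measurable q ∧ (∀ x, 0 ≤ q x) ∧ (∀ x, q x ≤ M) ∧ 0 ≤ C1 ∧
      (∀ x, G x ≤ q x) ∧ (∀ x, cv J q x ≤ q x / 2 + C1 * exp (l * x 0)) ∧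
      (∀ x, cv f q x ≤ C1 * exp (l * x 0)) := by
  obtain ⟨N, hN0, hN⟩ := choose_N hJ hJm hJl
  set κ : Rn n → ENNReal := fun y => ENNReal.ofReal (J y - N * exp (l * y 0)) with hκ
  have hκm : Measurable κ := (hJm.sub ((exp_meas l).const_mul _)).ennreal_ofReal
  have hκ1 : ∫⁻ y, κ y ≤ 1 / 8 := by
    refine le_trans (lintegral_mono fun y => ?_) hN
    refine le_mul_of_one_le_right (zero_le) ?_
    rw [ENNReal.one_le_ofReal]
    linarith [exp_pos (-l * y 0)]
  have hκ2 : ∫⁻ y : Rn n, κ y * ENNReal.ofReal (exp (-l * y 0)) ≤ 1 / 8 := by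
    refine le_trans (lintegral_mono fun y => ?_) hN
    gcongr
    linarith
  set A : (Rn n → ENNReal) → Rn n → ENNReal := fun g x => 2 * ∫⁻ y, κ y * g (x - y) with hA
  have hAm : ∀ g, Measurable g → Measurable (A g) := by
    intro g hg
    refine Measurable.const_mul ?_ 2
    apply Measurable.lintegral_prod_right' (f := fun p : Rn n × Rn n => κ p.2 * g (p.1 - p.2))
    exact (hκm.comp measurable_snd).mul (hg.comp (measurable_fst.sub measurable_snd))
  set g0 : Rn n → ENNReal := fun x => ENNReal.ofReal (G x) with hg0
  set Q : ℕ → Rn n → ENNReal := fun k => A^[k] g0 with hQ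
  have hQs : ∀ k, Q (k + 1) = A (Q k) := fun k => Function.iterate_succ_apply' A k g0
  have hQm : ∀ k, Measurable (Q k) := by
    intro k
    induction k with
    | zero => exact hGm.ennreal_ofReal
    | succ k ih => rw [hQs]; exact hAm _ ih
  have h28 : (2 : ENNReal) * (1 / 8) = 1 / 4 := by
    rw [show (8 : ENNReal) = 2 * 4 by norm_num, one_div, one_div, ENNReal.mul_inv (by simp) (by simp),
      ← mul_assoc, ENNReal.mul_inv_cancel (by simp) (by simp), one_mul]
  have hQU : ∀ k x, Q k x ≤ (1 / 4) ^ k * ENNReal.ofReal U := by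
    intro k
    induction k with
    | zero => intro x; rw [pow_zero, one_mul]; exact ENNReal.ofReal_le_ofReal (hGU x)
    | succ k ih =>
      intro x
      rw [hQs]
      calc A (Q k) x ≤ 2 * ∫⁻ y, κ y * ((1 / 4) ^ k * ENNReal.ofReal U) := by
            simp only [hA]; gcongr; exact ih _
        _ = 2 * ((∫⁻ y, κ y) * ((1 / 4) ^ k * ENNReal.ofReal U)) := by
            rw [lintegral_mul_const _ hκm]
        _ ≤ 2 * ((1 / 8) * ((1 / 4) ^ k * ENNReal.ofReal U)) := by gcongr
        _ = (1 / 4) ^ (k + 1) * ENNReal.ofReal U := by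
            rw [← mul_assoc, h28, pow_succ']; ring
  set e : Rn n → ENNReal := fun x => ENNReal.ofReal (exp (-l * x 0)) with he
  have hem : Measurable e := (exp_meas (-l)).ennreal_ofReal
  set I0 := ∫⁻ x, e x * g0 x with hI0
  have hI0t : I0 ≠ ⊤ := by
    have := hGl.lintegral_lt_top.ne
    convert this using 2
    ext y
    rw [ENNReal.ofReal_mul (exp_pos _).le]
  have hQI : ∀ k, ∫⁻ x, e x * Q k x ≤ (1 / 4) ^ k * I0 := by
    intro k
    induction k with
    | zero => simp [hQ, hI0]
    | succ k ih =>
      have hm2 : Measurable (fun p : Rn n × Rn n => e p.1 * (κ p.2 * Q k (p.1 - p.2))) :=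
        (hem.comp measurable_fst).mul ((hκm.comp measurable_snd).mul
          ((hQm k).comp (measurable_fst.sub measurable_snd)))
      calc ∫⁻ x, e x * Q (k + 1) x = ∫⁻ x, 2 * ∫⁻ y, e x * (κ y * Q k (x - y)) := by
            apply lintegral_congr; intro x
            rw [hQs, lintegral_const_mul' _ _ ENNReal.ofReal_ne_top]
            simp only [hA]; ring
        _ = 2 * ∫⁻ x, ∫⁻ y, e x * (κ y * Q k (x - y)) :=
            lintegral_const_mul' _ _ (by simp)
        _ = 2 * ∫⁻ y, ∫⁻ x, e x * (κ y * Q k (x - y)) := by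
            rw [lintegral_lintegral_swap hm2.aemeasurable]
        _ = 2 * ∫⁻ y, (κ y * e y) * ∫⁻ x, e x * Q k x := by
            congr 1
            apply lintegral_congr; intro y
            rw [← lintegral_sub_right_eq_self (fun x => e x * Q k x) y,
              ← lintegral_const_mul' _ _ (ENNReal.mul_ne_top ENNReal.ofReal_ne_top
                ENNReal.ofReal_ne_top)]
            apply lintegral_congr; intro x
            have : e x = e y * e (x - y) := by
              simp only [he]
              rw [← ENNReal.ofReal_mul (exp_pos _).le, ← exp_add]
              congr 2; simp; ring
            rw [this]; ring
        _ = 2 * ((∫⁻ y, κ y * e y) * ∫⁻ x, e x * Q k x) := by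
            rw [lintegral_mul_const _ (f := fun y => κ y * e y) (hκm.mul hem)]
        _ ≤ 2 * ((1 / 8) * ((1 / 4) ^ k * I0)) := by gcongr
        _ = (1 / 4) ^ (k + 1) * I0 := by rw [← mul_assoc, h28, pow_succ']; ring
  have hgeo : ∑' k : ℕ, ((1 : ENNReal) / 4) ^ k ≠ ⊤ := by
    rw [ENNReal.tsum_geometric]
    rw [ENNReal.inv_ne_top]
    have : (1 : ENNReal) / 4 < 1 := by
      rw [one_div]; exact ENNReal.inv_lt_one.2 (by norm_num)
    exact (tsub_pos_of_lt this).ne'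
  set Qt : Rn n → ENNReal := fun x => ∑' k, Q k x with hQt
  have hQtm : Measurable Qt := Measurable.tsum hQm
  set MM := (∑' k : ℕ, ((1 : ENNReal) / 4) ^ k) * ENNReal.ofReal U with hMM
  have hMMt : MM ≠ ⊤ := ENNReal.mul_ne_top hgeo ENNReal.ofReal_ne_top
  have hQtM : ∀ x, Qt x ≤ MM := by
    intro x
    rw [hMM, ← ENNReal.tsum_mul_right]
    exact ENNReal.tsum_le_tsum fun k => hQU k x
  have hQtt : ∀ x, Qt x ≠ ⊤ := fun x => ne_top_of_le_ne_top hMMt (hQtM x)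
  have hrec : ∀ x, Qt x = g0 x + 2 * ∫⁻ y, κ y * Qt (x - y) := by
    intro x
    have h1 : ∫⁻ y, κ y * Qt (x - y) = ∑' k, ∫⁻ y, κ y * Q k (x - y) := by
      simp only [hQt, ← ENNReal.tsum_mul_left]
      rw [lintegral_tsum]
      intro k
      exact (hκm.mul ((hQm k).comp (measurable_const.sub measurable_id))).aemeasurable
    rw [h1, ← ENNReal.tsum_mul_left]
    simp only [hQt]
    rw [tsum_eq_zero_add' ENNReal.summable]
    congr 1
    apply tsum_congr
    intro k
    rw [hQs]
  set I := ∫⁻ x, e x * Qt x with hI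
  have hIt : I ≠ ⊤ := by
    have h1 : I ≤ (∑' k : ℕ, ((1 : ENNReal) / 4) ^ k) * I0 := by
      simp only [hI, hQt, ← ENNReal.tsum_mul_left]
      rw [lintegral_tsum (f := fun k x => e x * Q k x) fun k => (hem.mul (hQm k)).aemeasurable, ← ENNReal.tsum_mul_right]
      exact ENNReal.tsum_le_tsum hQI
    exact ne_top_of_le_ne_top (ENNReal.mul_ne_top hgeo hI0t) h1
  have hIr : 0 ≤ I.toReal := ENNReal.toReal_nonneg
  have hconv : ∀ x, ∫⁻ y : Rn n, ENNReal.ofReal (exp (l * y 0)) * Qt (x - y) =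
      ENNReal.ofReal (exp (l * x 0) * I.toReal) := by
    intro x
    rw [lint_exp_conv, ENNReal.ofReal_mul (exp_pos _).le, ENNReal.ofReal_toReal hIt]
  refine ⟨fun x => (Qt x).toReal, MM.toReal, N * I.toReal + F * I.toReal, hQtm.ennreal_toReal,
    fun x => ENNReal.toReal_nonneg, fun x => ENNReal.toReal_mono hMMt (hQtM x), by positivity,
    ?_, ?_, ?_⟩
  · intro x
    have : g0 x ≤ Qt x := by rw [hrec]; exact le_self_add
    rw [hg0] at this
    exact (ENNReal.ofReal_le_iff_le_toReal (hQtt x)).1 this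
  · intro x
    refine cv_le_of_lint hJ.nonneg hJm hQtm hQtt (by positivity) x ?_
    have h1 : ∫⁻ y, κ y * Qt (x - y) ≤ ENNReal.ofReal ((Qt x).toReal / 2) := by
      have h2 : 2 * ∫⁻ y, κ y * Qt (x - y) ≤ Qt x := by
        conv_rhs => rw [hrec]
        exact le_add_self
      rw [ENNReal.ofReal_div_of_pos (by norm_num), ENNReal.ofReal_toReal (hQtt x),
        ENNReal.le_div_iff_mul_le (by simp) (by simp), mul_comm]
      simpa using h2
    calc ∫⁻ y, ENNReal.ofReal (J y) * Qt (x - y)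
        ≤ ∫⁻ y : Rn n, (κ y * Qt (x - y) +
            ENNReal.ofReal N * (ENNReal.ofReal (exp (l * y 0)) * Qt (x - y))) := by
          apply lintegral_mono; intro y
          beta_reduce
          rw [← mul_assoc, ← add_mul]
          gcongr
          rw [← ENNReal.ofReal_mul hN0]
          refine le_trans (ENNReal.ofReal_le_ofReal ?_) ENNReal.ofReal_add_le
          linarith
      _ = (∫⁻ y, κ y * Qt (x - y)) + ENNReal.ofReal N * ENNReal.ofReal (exp (l * x 0) * I.toReal) := by
          rw [lintegral_add_left (f := fun y => κ y * Qt (x - y)) (hκm.mul (hQtm.comp (measurable_const.sub measurable_id))),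
            lintegral_const_mul' _ _ ENNReal.ofReal_ne_top, hconv]
      _ ≤ ENNReal.ofReal ((Qt x).toReal / 2) +
          ENNReal.ofReal N * ENNReal.ofReal (exp (l * x 0) * I.toReal) := by gcongr
      _ ≤ _ := by
          rw [← ENNReal.ofReal_mul hN0, ← ENNReal.ofReal_add (by positivity) (by positivity)]
          apply ENNReal.ofReal_le_ofReal
          have : 0 ≤ F * I.toReal * exp (l * x 0) := by positivity
          nlinarith
  · intro x
    refine cv_le_of_lint hf.nonneg hfm hQtm hQtt (by positivity) x ?_
    calc ∫⁻ y, ENNReal.ofReal (f y) * Qt (x - y)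
        ≤ ∫⁻ y : Rn n, ENNReal.ofReal F * (ENNReal.ofReal (exp (l * y 0)) * Qt (x - y)) := by
          apply lintegral_mono; intro y
          beta_reduce
          rw [← mul_assoc]
          gcongr
          rw [← ENNReal.ofReal_mul hF]
          apply ENNReal.ofReal_le_ofReal
          have h1 := mul_le_mul_of_nonneg_right (hfl y) (exp_pos (l * y 0)).le
          rw [mul_assoc, ← exp_add] at h1
          simpa using h1
      _ = ENNReal.ofReal F * ENNReal.ofReal (exp (l * x 0) * I.toReal) := by
          rw [lintegral_const_mul' _ _ ENNReal.ofReal_ne_top, hconv]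
      _ ≤ _ := by
          rw [← ENNReal.ofReal_mul hF]
          apply ENNReal.ofReal_le_ofReal
          have : 0 ≤ N * I.toReal * exp (l * x 0) := by positivity
          nlinarith
end qlem

lemma wgt_ge_one {l xs x : ℝ} (hl : 0 < l) : 1 ≤ wgt l xs x := by
  unfold wgt
  split_ifs with h
  · exact one_le_exp (by nlinarith)
  · exact le_rfl

lemma wgt_ge_exp {l xs x : ℝ} (hl : 0 < l) : exp (-l * x) ≤ exp (-l * xs) * wgt l xs x := by
  unfold wgt
  split_ifs with h
  · rw [← exp_add]; exact exp_le_exp.2 (by nlinarith)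
  · rw [mul_one]; exact exp_le_exp.2 (by nlinarith)

lemma wgt_meas (l xs : ℝ) : Measurable (wgt l xs) := by
  unfold wgt
  refine Measurable.ite measurableSet_Iic ?_ measurable_const
  fun_prop

lemma G_exists {n : ℕ} [NeZero n] {v vs : ℝ → Rn n → ℝ} {τ U l xs : ℝ} (hτ : 0 < τ) (hl : 0 < l)
    (hU : 0 ≤ U)
    (hcont : ContinuousOn (fun p : ℝ × Rn n => v p.1 p.2) (Icc (-τ) 0 ×ˢ univ))
    (hvU : ∀ s ∈ Icc (-τ) 0, ∀ x, |v s x| ≤ U)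
    (hL1 : Integrable (fun x : Rn n => wgt l xs (x 0) * |v 0 x|))
    (hder : ∀ s ∈ Icc (-τ) 0, ∀ x, HasDerivAt (fun s => v s x) (vs s x) s)
    (hs1 : ∀ s ∈ Icc (-τ) 0, Integrable (fun x : Rn n => wgt l xs (x 0) * |vs s x|))
    (hsI : ∫⁻ s in Icc (-τ) 0, ENNReal.ofReal (∫ x : Rn n, wgt l xs (x 0) * |vs s x|) < ⊤) :
    ∃ G : Rn n → ℝ, Measurable G ∧ (∀ x, 0 ≤ G x) ∧ (∀ x, G x ≤ U) ∧
      (∀ s ∈ Icc (-τ) 0, ∀ x, |v s x| ≤ G x) ∧ Integrable G ∧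
      Integrable (fun x : Rn n => exp (-l * x 0) * G x) := by
  have hw1 : ∀ x, 1 ≤ wgt l xs x := fun x => wgt_ge_one hl
  have hw0 : ∀ x, 0 ≤ wgt l xs x := fun x => zero_le_one.trans (hw1 x)
  set vt : Rn n → ℝ → ℝ := fun x s => v (max (-τ) (min s 0)) x with hvt
  have hcl : ∀ s : ℝ, max (-τ) (min s 0) ∈ Icc (-τ) 0 := fun s =>
    ⟨le_max_left _ _, max_le (by linarith) (min_le_right _ _)⟩
  have hvtc : Continuous (Function.uncurry vt) := by
    have h1 := hcont.comp (f := fun p : Rn n × ℝ => (max (-τ) (min p.2 0), p.1)) (s := univ)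
      (by fun_prop) (fun p _ => ⟨hcl _, mem_univ _⟩)
    exact continuousOn_univ.1 h1
  have hDm : Measurable (fun p : Rn n × ℝ => deriv (vt p.1) p.2) :=
    measurable_deriv_with_param hvtc
  have hDeq : ∀ s ∈ Ioo (-τ) 0, ∀ x, deriv (vt x) s = vs s x := by
    intro s hs x
    have h1 := hder s ⟨hs.1.le, hs.2.le⟩ x
    refine (h1.congr_of_eventuallyEq ?_).deriv
    filter_upwards [Ioo_mem_nhds hs.1 hs.2] with r hr
    simp only [hvt]
    rw [min_eq_left hr.2.le, max_eq_right hr.1.le]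
  have hv0m : Measurable (v 0) := by
    have : Continuous (fun x => vt x 0) := hvtc.comp (continuous_id.prodMk continuous_const)
    have h2 : (fun x => vt x 0) = v 0 := by
      ext x; simp only [hvt]; rw [min_self, max_eq_right (by linarith)]
    rw [← h2]; exact this.measurable
  set Gh : Rn n → ENNReal := fun x => ENNReal.ofReal |v 0 x| +
    ∫⁻ s in Ioo (-τ) 0, ENNReal.ofReal |deriv (vt x) s| with hGh
  have hm2 : Measurable (fun p : Rn n × ℝ => ENNReal.ofReal |deriv (vt p.1) p.2|) :=
    hDm.abs.ennreal_ofReal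
  have hGhm : Measurable Gh :=
    hv0m.abs.ennreal_ofReal.add (Measurable.lintegral_prod_right' hm2)
  have hGhv : ∀ s ∈ Icc (-τ) 0, ∀ x, ENNReal.ofReal |v s x| ≤ Gh x := by
    intro s hs x
    by_cases hfin : ∫⁻ s in Ioo (-τ) 0, ENNReal.ofReal |deriv (vt x) s| = ⊤
    · simp [hGh, hfin]
    have hDx : Measurable (deriv (vt x)) := measurable_deriv _
    have hint : IntegrableOn (deriv (vt x)) (Ioo (-τ) 0) := by
      refine ⟨hDx.aestronglyMeasurable, ?_⟩
      rw [hasFiniteIntegral_iff_norm]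
      exact lt_top_iff_ne_top.2 hfin
    have hint2 : IntegrableOn (fun s => vs s x) (Ioo (-τ) 0) :=
      hint.congr_fun (fun r hr => hDeq r hr x) measurableSet_Ioo
    have hint3 : IntervalIntegrable (fun s => vs s x) volume s 0 := by
      rw [intervalIntegrable_iff_integrableOn_Ioo_of_le hs.2]
      exact hint2.mono_set (Ioo_subset_Ioo_left hs.1)
    have hftc := intervalIntegral.integral_eq_sub_of_hasDerivAt (f := fun s => v s x)
      (f' := fun s => vs s x) (a := s) (b := 0)
      (fun r hr => by
        rw [uIcc_of_le hs.2] at hr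
        exact hder r ⟨hs.1.trans hr.1, hr.2⟩ x) hint3
    rw [intervalIntegral.integral_of_le hs.2, integral_Ioc_eq_integral_Ioo] at hftc
    have h1 : ENNReal.ofReal |∫ r in Ioo s 0, vs r x| ≤
        ∫⁻ r in Ioo (-τ) 0, ENNReal.ofReal |deriv (vt x) r| := by
      rw [← Real.norm_eq_abs, ofReal_norm]
      refine (enorm_integral_le_lintegral_enorm _).trans ?_
      refine (lintegral_mono_set (Ioo_subset_Ioo_left hs.1)).trans (le_of_eq ?_)
      apply setLIntegral_congr_fun measurableSet_Ioo
      intro r hr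
      beta_reduce
      rw [hDeq r hr x, ← Real.norm_eq_abs, ofReal_norm]
    have h2 : |v s x| ≤ |v 0 x| + |∫ r in Ioo s 0, vs r x| := by
      rw [hftc]
      have := abs_sub (v 0 x) (v 0 x - v s x)
      simpa using this
    refine (ENNReal.ofReal_le_ofReal h2).trans ?_
    rw [ENNReal.ofReal_add (abs_nonneg _) (abs_nonneg _)]
    simp only [hGh]
    gcongr
  set W : Rn n → ENNReal := fun x => ENNReal.ofReal (wgt l xs (x 0)) with hW
  have hwm : Measurable (fun x : Rn n => wgt l xs (x 0)) := by
    have : Measurable (fun x : Rn n => x 0) := by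
      have : Continuous (fun x : Rn n => x 0) := by fun_prop
      exact this.measurable
    exact (wgt_meas l xs).comp this
  have hWm : Measurable W := hwm.ennreal_ofReal
  have hWI : ∫⁻ x, W x * Gh x < ⊤ := by
    simp only [hGh, mul_add]
    rw [lintegral_add_left (f := fun x => W x * ENNReal.ofReal |v 0 x|)
      (hWm.mul hv0m.abs.ennreal_ofReal)]
    apply ENNReal.add_lt_top.2 ⟨?_, ?_⟩
    · refine lt_of_le_of_lt (lintegral_mono fun x => ?_) hL1.lintegral_lt_top
      rw [ENNReal.ofReal_mul (hw0 _)]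
    · have h1 : ∀ x, W x * ∫⁻ s in Ioo (-τ) 0, ENNReal.ofReal |deriv (vt x) s| =
          ∫⁻ s in Ioo (-τ) 0, W x * ENNReal.ofReal |deriv (vt x) s| := fun x =>
        (lintegral_const_mul' _ _ ENNReal.ofReal_ne_top).symm
      simp_rw [h1]
      rw [lintegral_lintegral_swap (f := fun x s => W x * ENNReal.ofReal |deriv (vt x) s|)
        ((hWm.comp measurable_fst).mul hm2).aemeasurable]
      refine lt_of_le_of_lt ?_ hsI
      refine le_trans ?_ (lintegral_mono_set Ioo_subset_Icc_self)
      apply setLIntegral_mono' measurableSet_Ioo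
      intro s hs
      rw [ofReal_integral_eq_lintegral_ofReal (hs1 s ⟨hs.1.le, hs.2.le⟩)
        (Eventually.of_forall fun x => mul_nonneg (hw0 _) (abs_nonneg _))]
      apply lintegral_mono
      intro x
      beta_reduce
      rw [ENNReal.ofReal_mul (hw0 _), hDeq s hs x]
  set G : Rn n → ℝ := fun x => (min (Gh x) (ENNReal.ofReal U)).toReal with hG
  have hmt : ∀ x, min (Gh x) (ENNReal.ofReal U) ≠ ⊤ := fun x =>
    ne_top_of_le_ne_top ENNReal.ofReal_ne_top (min_le_right _ _)
  have hGm : Measurable G := (hGhm.min measurable_const).ennreal_toReal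
  have hG0 : ∀ x, 0 ≤ G x := fun x => ENNReal.toReal_nonneg
  have hGle : ∀ x, ENNReal.ofReal (G x) ≤ Gh x := fun x => by
    rw [hG, ENNReal.ofReal_toReal (hmt x)]; exact min_le_left _ _
  have hwG : Integrable (fun x : Rn n => wgt l xs (x 0) * G x) := by
    refine ⟨(hwm.mul hGm).aestronglyMeasurable, ?_⟩
    rw [hasFiniteIntegral_iff_ofReal (Eventually.of_forall fun x => mul_nonneg (hw0 _) (hG0 x))]
    refine lt_of_le_of_lt (lintegral_mono fun x => ?_) hWI
    rw [ENNReal.ofReal_mul (hw0 _)]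
    exact mul_le_mul_right (hGle x) _
  refine ⟨G, hGm, hG0, ?_, ?_, ?_, ?_⟩
  · intro x
    exact ENNReal.toReal_le_of_le_ofReal hU (min_le_right _ _)
  · intro s hs x
    rw [← ENNReal.ofReal_le_iff_le_toReal (hmt x)]
    exact le_min (hGhv s hs x) (ENNReal.ofReal_le_ofReal (hvU s hs x))
  · refine hwG.mono' hGm.aestronglyMeasurable (Eventually.of_forall fun x => ?_)
    rw [Real.norm_eq_abs, abs_of_nonneg (hG0 x)]
    exact le_mul_of_one_le_left (hG0 x) (hw1 _)
  · refine (hwG.const_mul (exp (-l * xs))).mono'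
      ((exp_meas (-l)).mul hGm).aestronglyMeasurable (Eventually.of_forall fun x => ?_)
    rw [Real.norm_eq_abs, abs_of_nonneg (mul_nonneg (exp_pos _).le (hG0 x)), ← mul_assoc]
    exact mul_le_mul_of_nonneg_right (wgt_ge_exp hl) (hG0 x)

lemma wave_mem {φ : ℝ → ℝ} {U : ℝ} (hmono : Monotone φ) (h0 : Tendsto φ atBot (nhds 0))
    (h1 : Tendsto φ atTop (nhds U)) (ξ : ℝ) : φ ξ ∈ Icc 0 U :=
  ⟨hmono.le_of_tendsto h0 ξ, hmono.ge_of_tendsto h1 ξ⟩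

lemma wave_sol {n : ℕ} [NeZero n] {d b : ℝ → ℝ} {U β τ c : ℝ} (hβ : 0 < β)
    {J₁ : Fin n → ℝ → ℝ} (hJunit : ∀ i, (∫ y : ℝ, J₁ i y) = 1)
    {φ φd : ℝ → ℝ} (hmem : ∀ ξ, φ ξ ∈ Icc 0 U)
    (hphid : ∀ ξ : ℝ, HasDerivAt φ (φd ξ) ξ)
    (hTW : ∀ ξ : ℝ, c * φd ξ - (∫ y : ℝ, J₁ 0 (ξ - y) * φ y) + φ ξ + d (φ ξ)
        = ∫ y : ℝ, heatKernel1 β y * b (φ (ξ - y - c * τ))) :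
    SolF (n := n) (fun x => ∏ i, J₁ i (x i)) (heatKernel n β) d b τ U
      (fun t x => φ (x 0 + c * t)) where
  cont := by
    have h1 : Continuous φ := continuous_iff_continuousAt.2 fun x => (hphid x).continuousAt
    have : Continuous (fun p : ℝ × Rn n => φ (p.2 0 + c * p.1)) := by fun_prop
    exact this.continuousOn
  mem := fun t _ x => hmem _
  der := by
    intro t _ x
    have h1 : HasDerivAt (fun t : ℝ => x 0 + c * t) c t := by
      have := ((hasDerivAt_id t).const_mul c).const_add (x 0)
      simpa using this
    have h2 := (hphid (x 0 + c * t)).comp t h1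
    have h3 : cv (fun x : Rn n => ∏ i, J₁ i (x i)) (fun x => φ (x 0 + c * t)) x =
        ∫ y : ℝ, J₁ 0 (x 0 + c * t - y) * φ y := by
      rw [← integral_sub_left_eq_self (fun y => J₁ 0 (x 0 + c * t - y) * φ y) _ (x 0 + c * t)]
      unfold cv
      have := prod_integral0 J₁ hJunit (fun y => φ (x 0 - y + c * t))
      simp only [PiLp.sub_apply]
      rw [this]
      congr 1; ext y
      congr 2
      · ring
      · ring
    have h4 : cv (heatKernel n β) (fun y => b (φ (y 0 + c * (t - τ)))) x =
        ∫ y : ℝ, heatKernel1 β y * b (φ (x 0 + c * t - y - c * τ)) := by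
      unfold cv
      have := prod_integral0 (n := n) (fun _ => heatKernel1 β) (fun _ => heat1_one hβ)
        (fun y => b (φ (x 0 - y + c * (t - τ))))
      simp only [PiLp.sub_apply, heat_eq_prod n hβ]
      rw [this]
      congr 1; ext y
      congr 3
      ring
    have h5 := hTW (x 0 + c * t)
    show HasDerivAt (φ ∘ fun t => x 0 + c * t) _ t
    refine h2.congr_deriv ?_
    rw [h3, h4]
    linarith

lemma NL_of {d b d' b' d'' b'' : ℝ → ℝ} {U : ℝ} (hU : 0 < U) (hd0 : d 0 = 0) (hb0 : b 0 = 0)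
    (hdbu : d U = b U)
    (hd'def : ∀ u ∈ Set.Icc 0 U, HasDerivAt d (d' u) u)
    (hb'def : ∀ u ∈ Set.Icc 0 U, HasDerivAt b (b' u) u)
    (hd''def : ∀ u ∈ Set.Icc 0 U, HasDerivAt d' (d'' u) u)
    (hb''def : ∀ u ∈ Set.Icc 0 U, HasDerivAt b' (b'' u) u)
    (h3 : ∀ u ∈ Set.Icc 0 U, 0 ≤ d' u ∧ 0 ≤ b' u ∧ 0 ≤ d'' u ∧ b'' u ≤ 0) :
    NL d b U (d' 0) (d' U) (b' 0) ∧ ConvexOn ℝ (Icc 0 U) d ∧ ConcaveOn ℝ (Icc 0 U) b := by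
  have c0 : (0:ℝ) ∈ Icc 0 U := ⟨le_rfl, hU.le⟩
  have cU : U ∈ Icc 0 U := ⟨hU.le, le_rfl⟩
  have hcv : Convex ℝ (Icc 0 U) := convex_Icc 0 U
  have hint : interior (Icc 0 U) ⊆ Icc 0 U := interior_subset
  have md : MonotoneOn d' (Icc 0 U) := by
    refine monotoneOn_of_deriv_nonneg hcv (fun x hx => (hd''def x hx).continuousAt.continuousWithinAt)
      (fun x hx => (hd''def x (hint hx)).differentiableAt.differentiableWithinAt) ?_
    intro x hx
    rw [(hd''def x (hint hx)).deriv]; exact (h3 x (hint hx)).2.2.1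
  have mb : AntitoneOn b' (Icc 0 U) := by
    refine antitoneOn_of_deriv_nonpos hcv (fun x hx => (hb''def x hx).continuousAt.continuousWithinAt)
      (fun x hx => (hb''def x (hint hx)).differentiableAt.differentiableWithinAt) ?_
    intro x hx
    rw [(hb''def x (hint hx)).deriv]; exact (h3 x (hint hx)).2.2.2
  have cd : ContinuousOn d (Icc 0 U) := fun x hx => (hd'def x hx).continuousAt.continuousWithinAt
  have cb : ContinuousOn b (Icc 0 U) := fun x hx => (hb'def x hx).continuousAt.continuousWithinAt
  have mvt : ∀ (g g' : ℝ → ℝ), (∀ u ∈ Set.Icc 0 U, HasDerivAt g (g' u) u) →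
      ∀ x ∈ Icc 0 U, ∀ y ∈ Icc 0 U, x ≤ y → ∃ z ∈ Icc 0 U, g y - g x = g' z * (y - x) := by
    intro g g' hg x hx y hy hxy
    rcases hxy.eq_or_lt with rfl | hlt
    · exact ⟨x, hx, by simp⟩
    obtain ⟨z, hz, h⟩ := exists_hasDerivAt_eq_slope g g' hlt
      (fun r hr => (hg r ⟨hx.1.trans hr.1, hr.2.trans hy.2⟩).continuousAt.continuousWithinAt)
      (fun r hr => hg r ⟨hx.1.trans hr.1.le, hr.2.le.trans hy.2⟩)
    refine ⟨z, ⟨hx.1.trans hz.1.le, hz.2.le.trans hy.2⟩, ?_⟩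
    rw [h]
    have : y - x ≠ 0 := by linarith
    field_simp
  refine ⟨⟨?_, ?_, ?_, ?_, (h3 0 c0).1, (h3 U cU).1, (h3 0 c0).2.1, cb, hb0, hd0, hdbu⟩, ?_, ?_⟩
  · intro x hx y hy hxy
    obtain ⟨z, hz, h⟩ := mvt d d' hd'def x hx y hy hxy
    rw [h]; exact mul_le_mul_of_nonneg_right (md c0 hz hz.1) (by linarith)
  · intro x hx y hy hxy
    obtain ⟨z, hz, h⟩ := mvt d d' hd'def x hx y hy hxy
    rw [h]; exact mul_le_mul_of_nonneg_right (md hz cU hz.2) (by linarith)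
  · intro x hx y hy hxy
    obtain ⟨z, hz, h⟩ := mvt b b' hb'def x hx y hy hxy
    rw [h]; exact mul_nonneg (h3 z hz).2.1 (by linarith)
  · intro x hx y hy hxy
    obtain ⟨z, hz, h⟩ := mvt b b' hb'def x hx y hy hxy
    rw [h]; exact mul_le_mul_of_nonneg_right (mb c0 hz hz.1) (by linarith)
  · refine MonotoneOn.convexOn_of_deriv hcv cd
      (fun x hx => (hd'def x (hint hx)).differentiableAt.differentiableWithinAt) ?_
    intro x hx y hy hxy
    rw [(hd'def x (hint hx)).deriv, (hd'def y (hint hy)).deriv]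
    exact md (hint hx) (hint hy) hxy
  · refine AntitoneOn.concaveOn_of_deriv hcv cb
      (fun x hx => (hb'def x (hint hx)).differentiableAt.differentiableWithinAt) ?_
    intro x hx y hy hxy
    rw [(hb'def x (hint hx)).deriv, (hb'def y (hint hy)).deriv]
    exact mb (hint hx) (hint hy) hxy

section st2
variable {n : ℕ} [NeZero n]

lemma tail_exists {k : Rn n → ℝ} (hk : Kern k) {ε : ℝ} (hε : 0 < ε) :
    ∃ R : ℝ, 0 ≤ R ∧ ∫ y : Rn n, k y * (if R < y 0 then (1:ℝ) else 0) ≤ ε := by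
  have hm : ∀ R : ℝ, Measurable (fun y : Rn n => if R < y 0 then (1:ℝ) else 0) := fun R => by
    have : Continuous (fun y : Rn n => y 0) := by fun_prop
    exact Measurable.ite (measurableSet_lt measurable_const this.measurable) measurable_const
      measurable_const
  have hlim : Tendsto (fun N : ℕ => ∫ y : Rn n, k y * (if (N:ℝ) < y 0 then (1:ℝ) else 0)) atTop
      (nhds (∫ _ : Rn n, (0:ℝ))) := by
    refine tendsto_integral_of_dominated_convergence k ?_ hk.int ?_ ?_
    · intro N
      exact hk.int.aestronglyMeasurable.mul (hm N).aestronglyMeasurable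
    · intro N
      refine Eventually.of_forall fun y => ?_
      rw [Real.norm_eq_abs, abs_mul, abs_of_nonneg (hk.nonneg y)]
      refine mul_le_of_le_one_right (hk.nonneg y) ?_
      split_ifs <;> simp
    · refine Eventually.of_forall fun y => ?_
      apply tendsto_const_nhds.congr'
      obtain ⟨N0, hN0⟩ := exists_nat_ge (y 0)
      filter_upwards [eventually_ge_atTop N0] with N hN
      have : (N0 : ℝ) ≤ N := by exact_mod_cast hN
      rw [if_neg (by linarith), mul_zero]
  simp only [integral_zero] at hlim
  obtain ⟨N, hN⟩ := (hlim.eventually (gt_mem_nhds hε)).exists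
  exact ⟨N, Nat.cast_nonneg _, hN.le⟩

lemma cv_tail {k : Rn n → ℝ} (hk : Kern k) {ε R : ℝ}
    (hR : ∫ y : Rn n, k y * (if R < y 0 then (1:ℝ) else 0) ≤ ε)
    {g : Rn n → ℝ} (hg : Measurable g) {M : ℝ} (hM : ∀ y, |g y| ≤ M) {A B : ℝ} (hB : 0 ≤ B)
    (x : Rn n) (hle : ∀ z : Rn n, g z ≤ A + (if z 0 < x 0 - R then B else 0)) :
    cv k g x ≤ A + B * ε := by
  have hm : Measurable (fun y : Rn n => if R < y 0 then (1:ℝ) else 0) := by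
    have : Continuous (fun y : Rn n => y 0) := by fun_prop
    exact Measurable.ite (measurableSet_lt measurable_const this.measurable) measurable_const
      measurable_const
  have i1 : Integrable (fun y : Rn n => k y * (if R < y 0 then (1:ℝ) else 0)) :=
    hk.integrable_mul hm.aestronglyMeasurable (M := 1) (fun y => by split_ifs <;> simp)
  have i2 := i1.const_mul B
  have i3 := hk.int.mul_const A
  have i4 : Integrable (fun y : Rn n => k y * A + B * (k y * (if R < y 0 then (1:ℝ) else 0))) :=
    i3.add i2
  have h1 : cv k g x ≤ ∫ y : Rn n, (k y * A + B * (k y * (if R < y 0 then (1:ℝ) else 0))) := by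
    unfold cv
    apply integral_mono (hk.cv_int hg hM x) i4
    intro y
    have h2 := mul_le_mul_of_nonneg_left (hle (x - y)) (hk.nonneg y)
    refine h2.trans (le_of_eq ?_)
    have h3 : ((x - y) 0 < x 0 - R) ↔ R < y 0 := by
      simp only [PiLp.sub_apply]; constructor <;> intro h <;> linarith
    simp only [h3]
    split_ifs <;> ring
  rw [integral_add i3 i2, hk.int_const, integral_const_mul] at h1
  have := mul_le_mul_of_nonneg_left hR hB
  linarith

lemma cv_tail_lower {k : Rn n → ℝ} (hk : Kern k) {ε R : ℝ}
    (hR : ∫ y : Rn n, k y * (if R < y 0 then (1:ℝ) else 0) ≤ ε)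
    {g : Rn n → ℝ} (hg : Measurable g) {M : ℝ} (hM : ∀ y, |g y| ≤ M) {m S : ℝ} (hm : 0 ≤ m)
    (hS : 0 ≤ S) (hg0 : ∀ y, 0 ≤ g y)
    (x : Rn n) (hle : ∀ z : Rn n, x 0 - R ≤ z 0 → m - S ≤ g z) :
    m - S - m * ε ≤ cv k g x := by
  have h1 := cv_tail hk hR (g := fun y => - g y) hg.neg (M := M)
    (fun y => by rw [abs_neg]; exact hM y) (A := S - m) hm x (fun z => by
      split_ifs with h
      · linarith [hg0 z]
      · linarith [hle z (by linarith)])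
  have h2 : cv k (fun y => - g y) x = - cv k g x := by
    unfold cv
    rw [← integral_neg]
    congr 1; ext y; ring
  linarith

lemma ball_big (V : ℝ) : ∃ L : ℝ, 1 ≤ L ∧ ∀ x : Rn n, V ≤ volume.real (Metric.ball x L) := by
  set B := volume.real (Metric.ball (0 : Rn n) 1) with hB
  have hBp : 0 < B := ENNReal.toReal_pos (Metric.measure_ball_pos _ _ one_pos).ne'
    measure_ball_lt_top.ne
  refine ⟨max 1 (V / B), le_max_left _ _, fun x => ?_⟩
  set L := max 1 (V / B) with hL
  have hL1 : 1 ≤ L := le_max_left _ _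
  have h1 : volume.real (Metric.ball x L) = L ^ n * B := by
    rw [measureReal_def, Measure.addHaar_ball _ _ (by linarith), ENNReal.toReal_mul,
      ENNReal.toReal_ofReal (by positivity)]
    simp [hB, measureReal_def]
  rw [h1]
  have h2 : L ≤ L ^ n := le_self_pow₀ hL1 (NeZero.ne n)
  have h3 : V / B ≤ L := le_max_right _ _
  rw [div_le_iff₀ hBp] at h3
  exact h3.trans (mul_le_mul_of_nonneg_right h2 hBp.le)

lemma window {f G : Rn n → ℝ} (hf : Kern f) (hfc : Continuous f) (hfp : ∀ y, 0 < f y)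
    (hGm : Measurable G) (hG0 : ∀ x, 0 ≤ G x) (hGi : Integrable G) {δ a b1 : ℝ} (hδ : 0 < δ)
    (hb1 : 0 < b1) :
    ∃ θ > 0, ∀ (g : Rn n → ℝ) (M : ℝ) (x : Rn n), Measurable g → (∀ y, 0 ≤ g y) → (∀ y, |g y| ≤ M) →
      (∀ z : Rn n, x 0 + a ≤ z 0 → G z ≤ δ → b1 ≤ g z) → θ ≤ cv f g x := by
  set Bad := {z : Rn n | δ < G z} with hBad
  have hBm : MeasurableSet Bad := measurableSet_lt measurable_const hGm
  have hBfin : volume Bad < ⊤ := by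
    have := hGi.measure_gt_lt_top hδ
    exact this
  obtain ⟨L, hL1, hL⟩ := ball_big (n := n) (volume.real Bad + 1)
  set c0 : Rn n := EuclideanSpace.single 0 (-(L + a)) with hc0
  obtain ⟨y0, hy0, hmin⟩ := (isCompact_closedBall c0 L).exists_isMinOn
    ⟨c0, Metric.mem_closedBall_self (by linarith)⟩ hfc.continuousOn
  refine ⟨f y0 * b1, mul_pos (hfp _) hb1, ?_⟩
  intro g M x hg hg0 hgM hz
  set E : Set (Rn n) := Metric.ball c0 L \ (fun y => x - y) ⁻¹' Bad with hE
  have hpre : volume ((fun y => x - y) ⁻¹' Bad) = volume Bad :=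
    (Measure.measurePreserving_sub_left volume x).measure_preimage hBm.nullMeasurableSet
  have hPm : MeasurableSet ((fun y => x - y) ⁻¹' Bad) :=
    (measurable_const.sub measurable_id) hBm
  have hEm : MeasurableSet E := measurableSet_ball.diff hPm
  have hEfin : volume E ≠ ⊤ := ne_top_of_le_ne_top (measure_ball_lt_top (x := c0) (r := L)).ne
    (measure_mono diff_subset)
  have hE1 : 1 ≤ volume.real E := by
    have h1 : volume.real (Metric.ball c0 L) ≤ volume.real E +
        volume.real ((fun y => x - y) ⁻¹' Bad) := by
      have hsub : Metric.ball c0 L ⊆ E ∪ ((fun y => x - y) ⁻¹' Bad) := fun y hy => by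
        by_cases h : y ∈ (fun y => x - y) ⁻¹' Bad
        · exact Or.inr h
        · exact Or.inl ⟨hy, h⟩
      refine (measureReal_mono hsub ?_).trans (measureReal_union_le _ _)
      exact ((measure_union_le _ _).trans_lt (ENNReal.add_lt_top.2
        ⟨lt_top_iff_ne_top.2 hEfin, by rw [hpre]; exact hBfin⟩)).ne
    have h2 : volume.real ((fun y => x - y) ⁻¹' Bad) = volume.real Bad := by
      rw [measureReal_def, hpre]; rfl
    linarith [hL c0]
  have hint := hf.cv_int hg hgM x
  have hnn : ∀ y, 0 ≤ f y * g (x - y) := fun y => mul_nonneg (hf.nonneg y) (hg0 _)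
  have hc : ∀ y ∈ E, f y0 * b1 ≤ f y * g (x - y) := by
    intro y hy
    have h1 : f y0 ≤ f y := hmin (Metric.ball_subset_closedBall hy.1)
    have h2 : b1 ≤ g (x - y) := by
      apply hz
      · have h3 : |(y - c0) 0| ≤ ‖y - c0‖ := by
          have := PiLp.norm_apply_le (y - c0) 0
          simpa using this
        have h4 : ‖y - c0‖ < L := by
          have := hy.1; rwa [Metric.mem_ball, dist_eq_norm] at this
        have h5 : (y - c0) 0 = y 0 + (L + a) := by simp [hc0]; ring
        rw [h5] at h3
        have h6 := (abs_le.1 h3).2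
        have h7 : (x - y) 0 = x 0 - y 0 := by simp
        rw [h7]; linarith
      · exact not_lt.1 hy.2
    exact mul_le_mul h1 h2 hb1.le (hf.nonneg y)
  calc f y0 * b1 ≤ f y0 * b1 * volume.real E :=
        le_mul_of_one_le_right (mul_nonneg (hf.nonneg _) hb1.le) hE1
    _ ≤ ∫ y in E, f y * g (x - y) := setIntegral_ge_of_const_le_real hEm hEfin hc hint.integrableOn
    _ ≤ cv f g x := setIntegral_le_integral hint (Eventually.of_forall hnn)
end st2

section st2b
variable {n : ℕ} [NeZero n] {J f : Rn n → ℝ} {d b : ℝ → ℝ} {τ U d0 D b0 : ℝ} {u : ℝ → Rn n → ℝ}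

lemma init_lower (hJ : Kern J) (hf : Kern f) (hn : NL d b U d0 D b0) (hτ : 0 < τ)
    (hu : SolF J f d b τ U u) (x : Rn n) {θ : ℝ} (hθ0 : 0 < θ)
    (hθ : ∀ s ∈ Icc (-τ) 0, θ ≤ cv f (fun y => b (u s y)) x) :
    ∀ t ≥ τ, θ * τ * exp (-(1 + D) * t) ≤ u t x := by
  have hDn := hn.Dnn
  set W : ℝ → ℝ := fun t => u t x * exp ((1 + D) * t) with hW
  have hE : ∀ t, HasDerivAt (fun t : ℝ => exp ((1 + D) * t)) (exp ((1 + D) * t) * (1 + D)) t := by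
    intro t
    have := ((hasDerivAt_id t).const_mul (1 + D)).exp
    simpa using this
  have hWd : ∀ t > 0, ∃ W', HasDerivAt W W' t ∧
      cv f (fun y => b (u (t - τ) y)) x * exp ((1 + D) * t) ≤ W' := by
    intro t ht
    have ht1 : -τ ≤ t := by linarith
    refine ⟨_, (hu.der t ht x).mul (hE t), ?_⟩
    have h1 := (cv_mem hJ (hu.cx ht1).measurable (hu.mem t ht1) x).1
    have hm := hu.mem t ht1 x
    have h2 := hn.dhi 0 ⟨le_rfl, hm.1.trans hm.2⟩ _ hm hm.1
    rw [hn.dz] at h2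
    have h3 := exp_pos ((1 + D) * t)
    have h4 : cv f (fun y => b (u (t - τ) y)) x ≤ (cv J (u t) x - u t x - d (u t x) +
      cv f (fun y => b (u (t - τ) y)) x) + (1 + D) * u t x := by linarith
    have h5 := mul_le_mul_of_nonneg_right h4 h3.le
    linarith
  have hWc : ContinuousOn W (Ici 0) := by
    refine ((hu.ct x).mono fun s hs => ?_).mul (by fun_prop)
    simp only [mem_Ici] at hs ⊢; linarith
  have hcvn : ∀ t > 0, 0 ≤ cv f (fun y => b (u (t - τ) y)) x := by
    intro t ht
    have ht2 : -τ ≤ t - τ := by linarith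
    exact (cv_mem hf (hu.cb hn ht2).measurable (fun y => hn.bmem (hu.mem _ ht2 y)) x).1
  have m1 : MonotoneOn (fun t => W t - θ * t) (Icc 0 τ) := by
    have hd : ∀ t ∈ Ioo 0 τ, ∃ W', HasDerivAt (fun t => W t - θ * t) W' t ∧ 0 ≤ W' := by
      intro t ht
      obtain ⟨W', h1, h2⟩ := hWd t ht.1
      refine ⟨W' - θ * 1, h1.sub ((hasDerivAt_id t).const_mul θ), ?_⟩
      have h3 := hθ (t - τ) ⟨by linarith [ht.1], by linarith [ht.2]⟩
      have h4 : 1 ≤ exp ((1 + D) * t) := one_le_exp (by have := ht.1; positivity)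
      have h5 := le_mul_of_one_le_right (hcvn t ht.1) h4
      linarith
    refine monotoneOn_of_deriv_nonneg (convex_Icc _ _)
      ((hWc.mono fun s hs => hs.1).sub (by fun_prop)) ?_ ?_
    · intro t ht
      rw [interior_Icc] at ht
      obtain ⟨W', h1, h2⟩ := hd t ht
      exact h1.differentiableAt.differentiableWithinAt
    · intro t ht
      rw [interior_Icc] at ht
      obtain ⟨W', h1, h2⟩ := hd t ht
      rw [h1.deriv]; exact h2
  have m2 : MonotoneOn W (Ici τ) := by
    have hd : ∀ t ∈ Ioi τ, ∃ W', HasDerivAt W W' t ∧ 0 ≤ W' := by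
      intro t ht
      have ht0 : 0 < t := hτ.trans ht
      obtain ⟨W', h1, h2⟩ := hWd t ht0
      exact ⟨W', h1, (mul_nonneg (hcvn t ht0) (exp_pos _).le).trans h2⟩
    refine monotoneOn_of_deriv_nonneg (convex_Ici _)
      (hWc.mono fun s hs => hτ.le.trans hs) ?_ ?_
    · intro t ht
      rw [interior_Ici] at ht
      obtain ⟨W', h1, h2⟩ := hd t ht
      exact h1.differentiableAt.differentiableWithinAt
    · intro t ht
      rw [interior_Ici] at ht
      obtain ⟨W', h1, h2⟩ := hd t ht
      rw [h1.deriv]; exact h2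
  intro t ht
  have h1 : (fun t => W t - θ * t) 0 ≤ (fun t => W t - θ * t) τ :=
    m1 ⟨le_rfl, hτ.le⟩ ⟨hτ.le, le_rfl⟩ hτ.le
  have h2 : W τ ≤ W t := m2 (mem_Ici.2 le_rfl) ht ht
  have h3 : 0 ≤ W 0 := mul_nonneg (hu.mem 0 (by linarith) x).1 (exp_pos _).le
  have h4 : θ * τ ≤ W t := by simp only at h1; linarith
  have h5 := mul_le_mul_of_nonneg_right h4 (exp_pos (-(1 + D) * t)).le
  have h6 : W t * exp (-(1 + D) * t) = u t x := by
    simp only [hW]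
    rw [mul_assoc, ← exp_add]
    have : (1 + D) * t + -(1 + D) * t = 0 := by ring
    rw [this, exp_zero, mul_one]
  linarith

set_option maxHeartbeats 1000000 in
lemma stage2 (hJ : Kern J) (hf : Kern f) (hfc : Continuous f) (hfp : ∀ y, 0 < f y)
    (hn : NL d b U d0 D b0) (hτ : 0 < τ) (hU : 0 < U)
    (hu : SolF J f d b τ U u) {φ : ℝ → ℝ} {c l μ M K : ℝ} (hc : 0 < c) (hl : 0 < l) (hμ : 0 < μ)
    (hM : 0 ≤ M) (hK : 0 ≤ K) (hmono : Monotone φ) (hlim : Tendsto φ atTop (nhds U))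
    (hst : ∀ t ≥ 0, ∀ x, |u t x - φ (x 0 + c * t)| ≤
      M * exp (-t / 2) + K * exp (l * (x 0 + c * t) - μ * t))
    {G : Rn n → ℝ} (hGm : Measurable G) (hG0 : ∀ x, 0 ≤ G x) (hGi : Integrable G)
    (hGu : ∀ s ∈ Icc (-τ) 0, ∀ x, |u s x - φ (x 0 + c * s)| ≤ G x)
    {κ m0 : ℝ} (hκ : 0 < κ) (hm0 : 0 < m0) (hm0U : m0 ≤ U / 4)
    (hκm : ∀ r ∈ Icc 0 m0, κ * r ≤ b r - d r) :
    ∃ T X m, 0 < T ∧ 0 < m ∧ m ≤ U / 4 ∧ m ≤ m0 ∧ U / 2 ≤ φ X ∧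
      ∀ t ≥ T, ∀ x : Rn n, X ≤ x 0 + c * t → m ≤ u t x := by
  have hb := hn.b0nn
  have hDn := hn.Dnn
  set ε := κ / (1 + b0) with hε
  have hεp : 0 < ε := by positivity
  have hεe : ε * (1 + b0) = κ := by rw [hε]; field_simp
  obtain ⟨R1, hR10, hR1⟩ := tail_exists hJ hεp
  obtain ⟨R2, hR20, hR2⟩ := tail_exists hf hεp
  set R' := max R1 R2 + c * τ with hR'
  have hcτ : 0 < c * τ := mul_pos hc hτ
  have hR'1 : R1 ≤ R' := by have := le_max_left R1 R2; linarith
  have hR'2 : R2 + c * τ ≤ R' := by have := le_max_right R1 R2; linarith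
  obtain ⟨X, hX⟩ := (hlim.eventually (lt_mem_nhds (by linarith : U / 2 < U))).exists
  -- choose T
  have hlimT : Tendsto (fun t : ℝ => M * exp (-t / 2) + K * exp (l * (X + R')) * exp (-μ * t)) atTop
      (nhds (M * 0 + K * exp (l * (X + R')) * 0)) := by
    refine Tendsto.add (Tendsto.const_mul _ ?_) (Tendsto.const_mul _ ?_)
    · refine tendsto_exp_atBot.comp ?_
      have : (fun t : ℝ => -t / 2) = fun t => (-(1:ℝ) / 2) * t := by ext; ring
      rw [this]
      exact tendsto_id.const_mul_atTop_of_neg (by norm_num)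
    · refine tendsto_exp_atBot.comp ?_
      exact tendsto_id.const_mul_atTop_of_neg (by linarith)
  simp only [mul_zero, add_zero] at hlimT
  obtain ⟨T0, hT0⟩ := eventually_atTop.1
    (hlimT.eventually (gt_mem_nhds (by linarith : (0:ℝ) < U / 4)))
  set T := max T0 (2 * τ) with hT
  have hTT0 : T0 ≤ T := le_max_left _ _
  have hT2 : 2 * τ ≤ T := le_max_right _ _
  have hTp : 0 < T := by linarith
  -- strip
  have hstrip : ∀ t ≥ T, ∀ x : Rn n, X ≤ x 0 + c * t → x 0 + c * t ≤ X + R' → U / 4 ≤ u t x := by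
    intro t ht x h1 h2
    have h3 := hst t (by linarith) x
    have h4 := hT0 t (hTT0.trans ht)
    have h5 : K * exp (l * (x 0 + c * t) - μ * t) ≤ K * exp (l * (X + R')) * exp (-μ * t) := by
      rw [mul_assoc, ← exp_add]
      apply mul_le_mul_of_nonneg_left _ hK
      apply exp_le_exp.2
      have := mul_le_mul_of_nonneg_left h2 hl.le
      linarith
    have h6 := hmono h1
    have h7 := (abs_le.1 h3).1
    linarith
  -- initial window
  have hbm0 : 0 < b m0 := by
    have h1 := hκm m0 ⟨hm0.le, le_rfl⟩
    have h2 := hn.dlo 0 ⟨le_rfl, hU.le⟩ m0 ⟨hm0.le, by linarith⟩ hm0.le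
    rw [hn.dz] at h2
    have h3 := mul_nonneg hn.d0nn (sub_nonneg.2 hm0.le)
    have h4 := mul_pos hκ hm0
    linarith
  obtain ⟨θ, hθ0, hθ⟩ := window hf hfc hfp hGm hG0 hGi (δ := U / 4) (a := c * T + c * τ)
    (b1 := b m0) (by linarith) hbm0
  have hinit : ∀ x : Rn n, X ≤ x 0 + c * T → ∀ t ≥ τ, θ * τ * exp (-(1 + D) * t) ≤ u t x := by
    intro x hx
    apply init_lower hJ hf hn hτ hu x hθ0
    intro s hs
    refine hθ _ (b U) x (hu.cb hn hs.1).measurable (fun y => (hn.bmem (hu.mem s hs.1 y)).1)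
      (hu.babs hn hs.1) ?_
    intro z hz hGz
    have hcs : -(c * τ) ≤ c * s := by
      have := mul_le_mul_of_nonneg_left hs.1 hc.le; linarith
    have h1 : φ X ≤ φ (z 0 + c * s) := hmono (by linarith)
    have h2 := (abs_le.1 (hGu s hs z)).1
    have h3 : m0 ≤ u s z := by linarith
    have h4 := hn.blo m0 ⟨hm0.le, by linarith⟩ _ (hu.mem s hs.1 z) h3
    linarith
  set θ1 := θ * τ * exp (-(1 + D) * T) with hθ1
  have hθ1p : 0 < θ1 := by positivity
  set m := min m0 θ1 with hm
  have hmp : 0 < m := lt_min hm0 hθ1p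
  have hmm0 : m ≤ m0 := min_le_left _ _
  have hmU : m ∈ Icc 0 U := ⟨hmp.le, by linarith⟩
  have hinit2 : ∀ x : Rn n, X ≤ x 0 + c * T → ∀ t ∈ Icc τ T, m ≤ u t x := by
    intro x hx t ht
    refine (min_le_right _ _).trans (le_trans ?_ (hinit x hx t ht.1))
    apply mul_le_mul_of_nonneg_left _ (by positivity)
    apply exp_le_exp.2
    nlinarith [ht.2]
  refine ⟨T, X, m, hTp, hmp, hmm0.trans hm0U, hmm0, hX.le, ?_⟩
  intro t ht x hx
  set q : ℝ → Rn n → ℝ := fun t x => if X ≤ x 0 + c * t then m - u t x else 0 with hq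
  have key := cmp_lemma q T t (1 + b0) m (by positivity) ?_ ?_ t ⟨ht, le_rfl⟩ x
  · simp only [hq, if_pos hx] at key; linarith
  · intro s hs y
    simp only [hq]
    split_ifs
    · linarith [(hu.mem s (by linarith [hs.1]) y).1]
    · exact hmp.le
  intro S hS hbd r hr y hpos
  have hyr : X ≤ y 0 + c * r := by
    by_contra h
    simp only [hq, if_neg h] at hpos
    exact lt_irrefl _ hpos
  have hur : u r y < m := by
    simp only [hq, if_pos hyr] at hpos; linarith
  have hyr2 : X + R' < y 0 + c * r := by
    by_contra h
    have := hstrip r hr.1 y hyr (not_lt.1 h)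
    linarith
  have hR'p : 0 < R' := by linarith
  set a := max T ((X + R' - y 0) / c) with ha
  have haT : T ≤ a := le_max_left _ _
  have hay : X + R' ≤ y 0 + c * a := by
    have h1 : (X + R' - y 0) / c ≤ a := le_max_right _ _
    rw [div_le_iff₀ hc] at h1
    linarith
  have har : a ≤ r := by
    apply max_le hr.1
    rw [div_le_iff₀ hc]; linarith
  have hge : ∀ s ≥ a, X + R' ≤ y 0 + c * s := fun s hs => by
    have := mul_le_mul_of_nonneg_left hs hc.le
    linarith
  have hua : m ≤ u a y := by
    rcases le_total ((X + R' - y 0) / c) T with h | h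
    · have haT : a = T := max_eq_left h
      rw [haT]
      rw [haT] at hay
      exact hinit2 y (by linarith) T ⟨by linarith, le_rfl⟩
    · have hae : a = (X + R' - y 0) / c := max_eq_right h
      have h2 : y 0 + c * a = X + R' := by rw [hae]; field_simp; ring
      exact (hmm0.trans hm0U).trans (hstrip a haT y (by linarith) h2.le)
  have hqe : ∀ s ≥ a, q s y = m - u s y := fun s hs => by
    simp only [hq]
    rw [if_pos]
    linarith [hge s hs]
  refine ⟨a, haT, har, by rw [hqe a le_rfl]; linarith, ?_, ?_⟩
  · have h1 : ContinuousOn (fun s => m - u s y) (Icc a r) :=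
      continuousOn_const.sub ((hu.ct y).mono fun s hs => by
        simp only [mem_Ici]; linarith [hs.1])
    exact h1.congr fun s hs => hqe s hs.1
  intro s hs hsp
  rw [hqe s hs.1.le] at hsp
  have hs0 : 0 < s := by linarith [hs.1]
  have hsT : T ≤ s := haT.trans hs.1.le
  have hs1 : -τ ≤ s := by linarith
  have hs2 : -τ ≤ s - τ := by linarith
  refine ⟨_, ((hu.der s hs0 y).const_sub m).congr_of_eventuallyEq ?_, ?_⟩
  · filter_upwards [lt_mem_nhds hs.1] with s' hs'
    exact hqe s' hs'.le
  set S' := S * exp (2 * (1 + b0) * s) with hS'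
  have hS'n : 0 ≤ S' := by positivity
  have hys := hge s hs.1.le
  have h1 := cv_tail_lower hJ hR1 (hu.cx hs1).measurable (hu.uabs hs1) hmp.le hS'n
    (fun z => (hu.mem s hs1 z).1) y (fun z hz => by
      have h2 := hbd s ⟨hsT, hs.2.le.trans hr.2⟩ z
      simp only [hq] at h2
      rw [if_pos (by linarith)] at h2
      linarith)
  have hbm := hn.bmem hmU
  have h2 := cv_tail_lower hf hR2 (hu.cb hn hs2).measurable (hu.babs hn hs2) hbm.1
    (mul_nonneg hb hS'n) (fun z => (hn.bmem (hu.mem _ hs2 z)).1) y (fun z hz => by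
      have hz1 : X ≤ z 0 + c * (s - τ) := by linarith
      have hum := hu.mem _ hs2 z
      have h3 : m - u (s - τ) z ≤ S' := by
        rcases le_or_gt T (s - τ) with h | h
        · have h4 := hbd (s - τ) ⟨h, by linarith [hs.2, hr.2]⟩ z
          simp only [hq] at h4
          rw [if_pos hz1] at h4
          have h5 : S * exp (2 * (1 + b0) * (s - τ)) ≤ S' := by
            refine mul_le_mul_of_nonneg_left (exp_le_exp.2 ?_) hS
            apply mul_le_mul_of_nonneg_left _ (by positivity)
            linarith
          linarith
        · have h4 := hinit2 z (by
            have := mul_le_mul_of_nonneg_left h.le hc.le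
            linarith) (s - τ) ⟨by linarith, h.le⟩
          linarith
      rcases le_total m (u (s - τ) z) with h | h
      · have := hn.blo m hmU _ hum h
        have := mul_nonneg hb hS'n
        linarith
      · have h4 := hn.bhi _ hum m hmU h
        have := mul_le_mul_of_nonneg_left h3 hb
        linarith)
  have hus := hu.mem s hs1 y
  have h3 : d (u s y) ≤ d m := by
    have h4 := hn.dlo _ hus m hmU (by linarith)
    have := mul_nonneg hn.d0nn (by linarith : 0 ≤ m - u s y)
    linarith
  have h4 := hκm m ⟨hmp.le, hmm0⟩
  have h5 : b m ≤ b0 * m := by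
    have := hn.bhi 0 ⟨le_rfl, hU.le⟩ m hmU hmp.le
    rw [hn.bz] at this; linarith
  have h6 := mul_le_mul_of_nonneg_left h5 hεp.le
  have h7 : m * (ε * (1 + b0)) = m * κ := by rw [hεe]
  linarith
end st2b

lemma secant_bd {g : ℝ → ℝ} {U m p : ℝ} (hg : ConvexOn ℝ (Icc 0 U) g) (hm : 0 ≤ m) (hmp : m < p)
    (hpU : p ≤ U) {x y : ℝ} (hx : m ≤ x) (hy : p ≤ y) (hyU : y ≤ U) (hxy : x ≤ y) :
    (g p - g m) / (p - m) * (y - x) ≤ g y - g x := by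
  rcases hxy.eq_or_lt with h | hlt
  · subst h; simp
  have hmm : m ∈ Icc 0 U := ⟨hm, by linarith⟩
  have hpm : p ∈ Icc 0 U := ⟨by linarith, hpU⟩
  have hxm : x ∈ Icc 0 U := ⟨by linarith, by linarith⟩
  have hym : y ∈ Icc 0 U := ⟨by linarith, hyU⟩
  have h1 := hg.secant_mono hmm hpm hym hmp.ne' (by linarith : m < y).ne' hy
  have h2 := hg.secant_mono hym hmm hxm (by linarith : m < y).ne hlt.ne hx
  have h3 : (g m - g y) / (m - y) = (g y - g m) / (y - m) := by
    rw [← neg_sub (g y), ← neg_sub y, neg_div_neg_eq]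
  have h4 : (g x - g y) / (x - y) = (g y - g x) / (y - x) := by
    rw [← neg_sub (g y), ← neg_sub y, neg_div_neg_eq]
  rw [h3, h4] at h2
  have h5 := h1.trans h2
  rwa [le_div_iff₀ (by linarith)] at h5

section st3
variable {n : ℕ} [NeZero n] {J f : Rn n → ℝ} {d b : ℝ → ℝ} {τ U d0 D b0 : ℝ} {u w : ℝ → Rn n → ℝ}

set_option maxHeartbeats 800000 in
lemma stage3 (hJ : Kern J) (hf : Kern f) (hn : NL d b U d0 D b0) (hτ : 0 < τ) (hU : 0 < U)
    (hu : SolF J f d b τ U u) (hw : SolF J f d b τ U w) {c l μ M K a B T X m p : ℝ}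
    (hc : 0 < c) (hl : 0 < l) (hμ : 0 < μ) (hM : 0 ≤ M) (hK : 0 ≤ K)
    (hst : ∀ t ≥ 0, ∀ x, |u t x - w t x| ≤
      M * exp (-t / 2) + K * exp (l * (x 0 + c * t) - μ * t))
    (hT : 0 ≤ T) (hum : ∀ t ≥ T, ∀ x : Rn n, X ≤ x 0 + c * t → m ≤ u t x)
    (hwp : ∀ t ≥ T, ∀ x : Rn n, X ≤ x 0 + c * t → p ≤ w t x)
    (hB : 0 ≤ B) (haB : B < a)
    (hsd : ∀ x ∈ Icc m U, ∀ y ∈ Icc p U, a * |x - y| ≤ |d x - d y|)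
    (hsb : ∀ x ∈ Icc m U, ∀ y ∈ Icc p U, |b x - b y| ≤ B * |x - y|) :
    ∃ K2 μ2 : ℝ, 0 < K2 ∧ 0 < μ2 ∧ ∀ t ≥ 0, ∀ x, |u t x - w t x| ≤ K2 * exp (-μ2 * t) := by
  have hb := hn.b0nn
  set ε := (a - B) / (4 * (1 + b0)) with hε
  have hεp : 0 < ε := div_pos (by linarith) (by positivity)
  have hεe : ε * (4 * (1 + b0)) = a - B := by rw [hε]; field_simp
  have hbε : B + b0 * ε < a := by nlinarith
  obtain ⟨R, hR0, hR⟩ := tail_exists hf hεp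
  -- choose the rate
  obtain ⟨μ2, hμ20, hμ2μ, hμ2h, hμ2⟩ : ∃ μ2 : ℝ, 0 < μ2 ∧ μ2 ≤ μ ∧ μ2 ≤ 1 / 2 ∧
      (B + b0 * ε) * exp (μ2 * τ) + μ2 < a := by
    have hct : ContinuousAt (fun r : ℝ => (B + b0 * ε) * exp (r * τ) + r) 0 := by fun_prop
    have hev := hct.eventually (gt_mem_nhds (show (B + b0 * ε) * exp (0 * τ) + 0 < a by simpa using hbε))
    have hev2 := (hev.filter_mono nhdsWithin_le_nhds : ∀ᶠ r in nhdsWithin (0:ℝ) (Ioi 0), _)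
    have hev3 : ∀ᶠ r in nhdsWithin (0:ℝ) (Ioi 0), r < min μ (1/2) :=
      (eventually_lt_nhds (by positivity)).filter_mono nhdsWithin_le_nhds
    obtain ⟨r, ⟨h1, h2⟩, h3⟩ := ((hev2.and hev3).and self_mem_nhdsWithin).exists
    have h3' : 0 < r := h3
    exact ⟨r, h3', (h2.trans_le (min_le_left _ _)).le, (h2.trans_le (min_le_right _ _)).le, h1⟩
  set T3 := T + τ with hT3
  set X' := X + c * τ + R with hX'
  set K2 := U * exp (μ2 * T3) + M + K * exp (l * X') with hK2
  have hK2p : 0 < K2 := by positivity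
  set V : ℝ → ℝ := fun t => K2 * exp (-μ2 * t) with hV
  have hVn : ∀ t, 0 ≤ V t := fun t => by positivity
  have hearly : ∀ t, -τ ≤ t → t ≤ T3 → ∀ x, |u t x - w t x| ≤ V t := by
    intro t ht ht3 x
    refine (hu.dU hw ht x).trans ?_
    have h1 : U ≤ U * exp (μ2 * T3) * exp (-μ2 * t) := by
      rw [mul_assoc, ← exp_add]
      refine le_mul_of_one_le_right hU.le (one_le_exp ?_)
      nlinarith
    refine h1.trans (mul_le_mul_of_nonneg_right ?_ (exp_pos _).le)
    have : 0 ≤ K * exp (l * X') := by positivity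
    linarith
  have hleft : ∀ t ≥ 0, ∀ x : Rn n, x 0 + c * t ≤ X' → |u t x - w t x| ≤ V t := by
    intro t ht x hx
    refine (hst t ht x).trans ?_
    have h1 : exp (-t / 2) ≤ exp (-μ2 * t) := exp_le_exp.2 (by nlinarith)
    have h2 : exp (l * (x 0 + c * t) - μ * t) ≤ exp (l * X') * exp (-μ2 * t) := by
      rw [← exp_add]
      refine exp_le_exp.2 ?_
      nlinarith
    have h3 := mul_le_mul_of_nonneg_left h1 hM
    have h4 := mul_le_mul_of_nonneg_left h2 hK
    have h5 : 0 ≤ U * exp (μ2 * T3) * exp (-μ2 * t) := by positivity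
    simp only [hV, hK2]
    nlinarith
  have hVd : ∀ t, HasDerivAt V (-μ2 * V t) t := by
    intro t
    have := (((hasDerivAt_id t).const_mul (-μ2)).exp).const_mul K2
    refine this.congr_deriv ?_
    simp only [hV, id]; ring
  have hVτ : ∀ t, V (t - τ) = exp (μ2 * τ) * V t := by
    intro t
    simp only [hV]
    rw [mul_left_comm, ← exp_add]; ring_nf
  refine ⟨K2, μ2, hK2p, hμ20, ?_⟩
  intro t ht x
  rcases le_or_gt t T3 with htT | htT
  · exact hearly t (by linarith) htT x
  have ha : 0 < a := by linarith
  have hT30 : 0 < T3 := by linarith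
  have key := cmp_lemma (fun t x => |u t x - w t x| - V t) T3 t (1 + a) U (by positivity)
    (fun s hs x => by
      have h1 := hu.dU hw (by linarith [hs.1] : -τ ≤ s) x
      have h2 := hVn s
      linarith) ?_ t ⟨htT.le, le_rfl⟩ x
  · exact sub_nonpos.1 key
  intro S hS hbd r hr y hpos
  have hry : X' < y 0 + c * r := by
    by_contra hcon
    have := hleft r (by linarith [hr.1]) y (not_lt.1 hcon)
    linarith
  have hs1c : ∀ s, (X' - y 0) / c ≤ s → X' ≤ y 0 + c * s := by
    intro s hs
    rw [div_le_iff₀ hc] at hs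
    linarith
  refine ⟨max T3 ((X' - y 0) / c), le_max_left _ _, max_le hr.1 ?_, ?_, ?_, ?_⟩
  · rw [div_le_iff₀ hc]; linarith
  · rcases le_total T3 ((X' - y 0) / c) with h | h
    · rw [max_eq_right h]
      refine sub_nonpos.2 (hleft _ (by linarith) y ?_)
      rw [mul_div_cancel₀ _ hc.ne']; linarith
    · rw [max_eq_left h]
      exact sub_nonpos.2 (hearly T3 (by linarith) le_rfl y)
  · refine ContinuousOn.sub ((hu.dct hw y).mono fun s hs => ?_) ?_
    · have := (le_max_left T3 ((X' - y 0) / c)).trans hs.1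
      simp only [mem_Ici]; linarith
    · exact fun s _ => (hVd s).continuousAt.continuousWithinAt
  intro s hs hsp
  have hsT : T3 < s := (le_max_left _ _).trans_lt hs.1
  have hsX : X' ≤ y 0 + c * s := hs1c s ((le_max_right _ _).trans hs.1.le)
  have hs1 : -τ ≤ s := by linarith
  have hs2 : -τ ≤ s - τ := by linarith
  have hVs := hVn s
  have hsp' : 0 < |u s y - w s y| - V s := hsp
  obtain ⟨q', hq', hle⟩ := diff_der hJ hf hn hτ hu hw (by linarith : 0 < s) y (by linarith)
  refine ⟨_, hq'.sub (hVd s), ?_⟩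
  set S' := S * exp (2 * (1 + a) * s) with hS'
  have hS'n : 0 ≤ S' := by positivity
  have hnow : ∀ z, |u s z - w s z| ≤ V s + S' := by
    intro z
    have h1 : |u s z - w s z| - V s ≤ S' := hbd s ⟨hsT.le, by linarith [hs.2, hr.2]⟩ z
    linarith
  set Z := V (s - τ) + S' with hZ
  have hZn : 0 ≤ Z := add_nonneg (hVn _) hS'n
  have hpast : ∀ z, |u (s - τ) z - w (s - τ) z| ≤ Z := by
    intro z
    rcases le_or_gt (s - τ) T3 with h | h
    · have := hearly (s - τ) hs2 h z
      linarith
    · have h1 : |u (s - τ) z - w (s - τ) z| - V (s - τ) ≤ S * exp (2 * (1 + a) * (s - τ)) :=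
        hbd (s - τ) ⟨h.le, by linarith [hs.2, hr.2]⟩ z
      have h2 : S * exp (2 * (1 + a) * (s - τ)) ≤ S' := by
        refine mul_le_mul_of_nonneg_left (exp_le_exp.2 ?_) hS
        exact mul_le_mul_of_nonneg_left (by linarith) (by linarith)
      linarith
  have hJb : cv J (fun z => |u s z - w s z|) y ≤ V s + S' :=
    (cv_mem hJ ((hu.cx hs1).sub (hw.cx hs1)).abs.measurable
      (fun z => ⟨abs_nonneg _, hnow z⟩) y).2
  have hfb : cv f (fun z => |b (u (s - τ) z) - b (w (s - τ) z)|) y ≤ B * Z + b0 * Z * ε := by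
    refine cv_tail hf hR (A := B * Z) (B := b0 * Z) ((hu.cb hn hs2).sub (hw.cb hn hs2)).abs.measurable (M := b0 * Z)
      (fun z => ?_) (by positivity) y (fun z => ?_)
    · rw [abs_abs]
      exact (hn.babs (hu.mem _ hs2 z) (hw.mem _ hs2 z)).trans
        (mul_le_mul_of_nonneg_left (hpast z) hb)
    · change |b (u (s - τ) z) - b (w (s - τ) z)| ≤ _
      split_ifs with hz
      · have := (hn.babs (hu.mem _ hs2 z) (hw.mem _ hs2 z)).trans
          (mul_le_mul_of_nonneg_left (hpast z) hb)
        have h0 : 0 ≤ B * Z := by positivity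
        linarith
      · have hz' : X ≤ z 0 + c * (s - τ) := by
          have := not_lt.1 hz
          linarith
        have hsT' : s - τ ≥ T := by linarith
        have := (hsb _ ⟨hum _ hsT' z hz', (hu.mem _ hs2 z).2⟩ _
          ⟨hwp _ hsT' z hz', (hw.mem _ hs2 z).2⟩).trans (mul_le_mul_of_nonneg_left (hpast z) hB)
        linarith
  have hcτ : 0 < c * τ := mul_pos hc hτ
  have hd := hsd _ ⟨hum s (by linarith) y (by linarith), (hu.mem _ hs1 y).2⟩ _
    ⟨hwp s (by linarith) y (by linarith), (hw.mem _ hs1 y).2⟩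
  have hd2 : a * V s ≤ a * |u s y - w s y| := mul_le_mul_of_nonneg_left (by linarith) ha.le
  have hZe : Z = exp (μ2 * τ) * V s + S' := by rw [hZ, hVτ]
  have e1 : B * Z + b0 * Z * ε = (B + b0 * ε) * exp (μ2 * τ) * V s + (B + b0 * ε) * S' := by
    rw [hZe]; ring
  have e2 := mul_le_mul_of_nonneg_right hμ2.le hVs
  have e3 := mul_le_mul_of_nonneg_right hbε.le hS'n
  linarith
end st3

lemma kappa_exists {h : ℝ → ℝ} {k U : ℝ} (hk : 0 < k) (hU : 0 < U) (h0 : h 0 = 0)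
    (hd : HasDerivAt h k 0) : ∃ κ m0, 0 < κ ∧ 0 < m0 ∧ m0 ≤ U / 4 ∧ ∀ r ∈ Icc 0 m0, κ * r ≤ h r := by
  have h1 := hd.isLittleO.def (show 0 < k / 2 by positivity)
  rw [Metric.eventually_nhds_iff] at h1
  obtain ⟨δ, hδ, H⟩ := h1
  refine ⟨k / 2, min (δ / 2) (U / 4), by positivity, by positivity, min_le_right _ _, ?_⟩
  intro r hr
  have h2 : r < δ := by linarith [hr.2.trans (min_le_left _ _)]
  have h3 := H (y := r) (by rw [Real.dist_eq, sub_zero, abs_of_nonneg hr.1]; exact h2)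
  simp only [h0, sub_zero, smul_eq_mul, Real.norm_eq_abs, abs_of_nonneg hr.1] at h3
  have := (abs_le.1 h3).1
  linarith

lemma final_rate {K2 μ2 mu r : ℝ} (hK2 : 0 < K2) (hmu : mu < μ2) (hr : 0 ≤ r) :
    ∃ C > (0:ℝ), ∀ t > (0:ℝ), K2 * exp (-μ2 * t) ≤ C * (1 + t) ^ (-r) * exp (-mu * t) := by
  set δ := min 1 ((μ2 - mu) / (1 + r)) with hδ
  have hδp : 0 < δ := lt_min one_pos (div_pos (by linarith) (by linarith))
  have hδ1 : δ ≤ 1 := min_le_left _ _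
  have hδr : δ * r ≤ μ2 - mu := by
    have h1 : δ * (1 + r) ≤ μ2 - mu := by
      rw [← le_div_iff₀ (by linarith)]; exact min_le_right _ _
    nlinarith
  refine ⟨K2 * (δ⁻¹) ^ r, by positivity, ?_⟩
  intro t ht
  have h1 : 1 + t ≤ δ⁻¹ * exp (δ * t) := by
    rw [inv_mul_eq_div, le_div_iff₀ hδp]
    have := add_one_le_exp (δ * t)
    nlinarith
  have h2 : (1 + t) ^ r ≤ δ⁻¹ ^ r * exp (δ * t * r) := by
    refine (rpow_le_rpow (by positivity) h1 hr).trans ?_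
    rw [mul_rpow (by positivity) (by positivity), ← exp_mul]
  rw [rpow_neg (by positivity)]
  have h3 : 0 < (1 + t) ^ r := by positivity
  have h4 : exp (-μ2 * t) * exp (δ * t * r) ≤ exp (-mu * t) := by
    rw [← exp_add]
    refine exp_le_exp.2 ?_
    nlinarith
  have h5 : exp (-μ2 * t) * (1 + t) ^ r ≤ δ⁻¹ ^ r * exp (-mu * t) := by
    calc exp (-μ2 * t) * (1 + t) ^ r ≤ exp (-μ2 * t) * (δ⁻¹ ^ r * exp (δ * t * r)) :=
          mul_le_mul_of_nonneg_left h2 (exp_pos _).le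
      _ = δ⁻¹ ^ r * (exp (-μ2 * t) * exp (δ * t * r)) := by ring
      _ ≤ _ := mul_le_mul_of_nonneg_left h4 (by positivity)
  have h6 : K2 * δ⁻¹ ^ r * ((1 + t) ^ r)⁻¹ * exp (-mu * t)
      = K2 * (δ⁻¹ ^ r * exp (-mu * t)) / (1 + t) ^ r := by
    rw [div_eq_mul_inv]; ring
  rw [h6, le_div_iff₀ h3, mul_assoc]
  exact mul_le_mul_of_nonneg_left h5 hK2.le

section ex2
variable {n : ℕ} {J f : Rn n → ℝ} {d b : ℝ → ℝ} {τ U d0 D b0 : ℝ}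

/-- clamp to `[0,U]` -/
def clampU (U y : ℝ) : ℝ := max 0 (min U y)

lemma clampU_mono (U : ℝ) : Monotone (clampU U) := fun _ _ h =>
  max_le_max le_rfl (min_le_min le_rfl h)

lemma clampU_mem (hU : 0 ≤ U) (y : ℝ) : clampU U y ∈ Icc 0 U :=
  ⟨le_max_left _ _, max_le hU (min_le_left _ _)⟩

lemma clampU_eq {y : ℝ} (hy : y ∈ Icc 0 U) : clampU U y = y := by
  unfold clampU
  rw [min_eq_right hy.2, max_eq_right hy.1]

lemma clampU_lip {x y : ℝ} (h : x ≤ y) : clampU U y - clampU U x ≤ y - x := by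
  unfold clampU
  rcases le_total U x with h1 | h1 <;> rcases le_total U y with h2 | h2 <;>
    rcases le_total 0 x with h3 | h3 <;> rcases le_total 0 y with h4 | h4 <;>
    rcases le_total 0 U with h5 | h5 <;>
    simp only [min_eq_left, min_eq_right, max_eq_left, max_eq_right, h1, h2, h3, h4, h5] <;> linarith

lemma lip_clamp {g : ℝ → ℝ} {A : ℝ} (hA : 0 ≤ A) (hU : 0 ≤ U)
    (hlo : ∀ x ∈ Icc 0 U, ∀ y ∈ Icc 0 U, x ≤ y → 0 ≤ g y - g x)
    (hhi : ∀ x ∈ Icc 0 U, ∀ y ∈ Icc 0 U, x ≤ y → g y - g x ≤ A * (y - x)) :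
    Monotone (g ∘ clampU U) ∧ (∀ x y, |(g ∘ clampU U) y - (g ∘ clampU U) x| ≤ A * |y - x|) ∧
      Continuous (g ∘ clampU U) := by
  have hmono : Monotone (g ∘ clampU U) := fun x y h => by
    have := hlo _ (clampU_mem hU x) _ (clampU_mem hU y) (clampU_mono U h)
    simp only [Function.comp]; linarith
  have h1 : ∀ x y, x ≤ y → |(g ∘ clampU U) y - (g ∘ clampU U) x| ≤ A * |y - x| := by
    intro x y h
    rw [abs_of_nonneg (sub_nonneg.2 (hmono h)), abs_of_nonneg (sub_nonneg.2 h)]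
    exact (hhi _ (clampU_mem hU x) _ (clampU_mem hU y) (clampU_mono U h)).trans
      (mul_le_mul_of_nonneg_left (clampU_lip h) hA)
  have h2 : ∀ x y, |(g ∘ clampU U) y - (g ∘ clampU U) x| ≤ A * |y - x| := by
    intro x y
    rcases le_total x y with h | h
    · exact h1 x y h
    · rw [abs_sub_comm, abs_sub_comm y]; exact h1 y x h
  refine ⟨hmono, h2, ?_⟩
  have : LipschitzWith ⟨A, hA⟩ (g ∘ clampU U) := LipschitzWith.of_dist_le_mul fun x y => by
    rw [Real.dist_eq, Real.dist_eq]; exact h2 y x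
  exact this.continuous

lemma exists_sol2 (hJ : Kern J) (hf : Kern f) (hn : NL d b U d0 D b0) (hτ : 0 < τ) (hU : 0 < U)
    {u₀ : ℝ → Rn n → ℝ}
    (hc : ContinuousOn (fun p : ℝ × Rn n => u₀ p.1 p.2) (Icc (-τ) 0 ×ˢ univ))
    (hbd : ∀ s ∈ Icc (-τ) 0, ∀ x, 0 ≤ u₀ s x ∧ u₀ s x ≤ U) :
    ∃ u, SolF J f d b τ U u ∧ (∀ s ∈ Icc (-τ) 0, ∀ x, u s x = u₀ s x) ∧
      (∀ x, Continuous fun t =>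
        (cv J (u t) x - u t x - d (u t x) + cv f (fun y => b (u (t - τ) y)) x)) := by
  obtain ⟨d1, d2, d3⟩ := lip_clamp hn.Dnn hU.le (g := d)
    (fun x hx y hy h => (mul_nonneg hn.d0nn (sub_nonneg.2 h)).trans (hn.dlo x hx y hy h)) hn.dhi
  obtain ⟨b1, b2, b3⟩ := lip_clamp hn.b0nn hU.le (g := b) hn.blo hn.bhi
  have hm0 : (0:ℝ) ∈ Icc 0 U := ⟨le_rfl, hU.le⟩
  have hmU : U ∈ Icc 0 U := ⟨hU.le, le_rfl⟩
  have hmem : ∀ t : ℝ, max (-τ) (min t 0) ∈ Icc (-τ) 0 := fun t =>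
    ⟨le_max_left _ _, max_le (by linarith) (min_le_right _ _)⟩
  have hhc : Continuous (fun p : ℝ × Rn n => u₀ (max (-τ) (min p.1 0)) p.2) := by
    refine hc.comp_continuous (f := fun p : ℝ × Rn n => (max (-τ) (min p.1 0), p.2)) (by fun_prop) ?_
    intro p
    exact ⟨hmem p.1, mem_univ _⟩
  obtain ⟨u, ⟨hu1, hu2, hu3⟩, hu4, hu5⟩ := exists_sol (h := fun t x => u₀ (max (-τ) (min t 0)) x)
    (d := d ∘ clampU U) (b := b ∘ clampU U) hJ hf d3 b3 d1 b1
    (by simp [clampU_eq hm0, hn.bz]) (by simp [clampU_eq hm0, hn.dz])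
    (by simp [clampU_eq hmU, hn.eqU]) hU.le hn.Dnn hn.b0nn hτ.le d2 b2 hhc
    (fun t x => hbd _ (hmem t) x)
  have e1 : ∀ t x, (d ∘ clampU U) (u t x) = d (u t x) := fun t x => by
    simp only [Function.comp, clampU_eq (hu2 t x)]
  have e2 : ∀ t x, (b ∘ clampU U) (u t x) = b (u t x) := fun t x => by
    simp only [Function.comp, clampU_eq (hu2 t x)]
  simp only [e1, e2] at hu4 hu5
  refine ⟨u, ⟨hu1.continuousOn, fun t _ x => hu2 t x, hu5⟩, ?_, hu4⟩
  intro s hs x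
  rw [hu3 s hs.2 x]
  simp only [min_eq_left hs.2, max_eq_right hs.1]

lemma cv_form (k g : Rn n → ℝ) (x : Rn n) : ∫ y, k (x - y) * g y = cv k g x := by
  unfold cv
  rw [← integral_sub_left_eq_self (fun y => k y * g (x - y)) volume x]
  simp
end ex2

section app
variable {n : ℕ} [NeZero n]

lemma heat_cont (β : ℝ) : Continuous (heatKernel n β) := by
  unfold heatKernel; fun_prop

lemma heat_pos {β : ℝ} (hβ : 0 < β) (y : Rn n) : 0 < heatKernel n β y := by
  unfold heatKernel; positivity

lemma heat_exp_int {β : ℝ} (hβ : 0 < β) (l : ℝ) :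
    Integrable (fun y : Rn n => heatKernel n β y * exp (-l * y 0)) ∧
      ∫ y : Rn n, heatKernel n β y * exp (-l * y 0) = exp (β * l ^ 2) := by
  have h : (fun y : Rn n => heatKernel n β y * exp (-l * y 0)) =
      fun y : Rn n => (∏ i, (fun _ : Fin n => heatKernel1 β) i (y i)) * exp (-l * y 0) := by
    funext y; rw [heat_eq_prod n hβ y]
  rw [h]
  constructor
  · refine prod_integrable0 (fun _ => heatKernel1 β) ?_ (fun y => exp (-l * y)) ?_
    · exact fun i => integrable_of_int_one (heat1_one hβ)
    · exact heat1_exp_int hβ l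
  · rw [prod_integral0 (fun _ => heatKernel1 β) ?_ (fun y => exp (-l * y))]
    · exact heat1_exp_val hβ l
    · exact fun i => heat1_one hβ
end app

lemma stage23 {n : ℕ} [NeZero n] {J f : Rn n → ℝ} {d b : ℝ → ℝ} {τ U d0 D b0 : ℝ}
    {u : ℝ → Rn n → ℝ} (hJ : Kern J) (hf : Kern f) (hfc : Continuous f) (hfp : ∀ y, 0 < f y)
    (hn : NL d b U d0 D b0) (hdc : ContinuousOn d (Icc 0 U)) (hcd : ConvexOn ℝ (Icc 0 U) d)
    (hcb : ConcaveOn ℝ (Icc 0 U) b) (hτ : 0 < τ) (hU : 0 < U)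
    {φ : ℝ → ℝ} {c l μ M K : ℝ}
    (hu : SolF J f d b τ U u) (hw : SolF J f d b τ U (fun t x => φ (x 0 + c * t)))
    (hφ : ∀ ξ, φ ξ ∈ Icc 0 U)
    (hc : 0 < c) (hl : 0 < l) (hμ : 0 < μ)
    (hM : 0 ≤ M) (hK : 0 ≤ K) (hmono : Monotone φ) (hlim : Tendsto φ atTop (nhds U))
    (hst : ∀ t ≥ 0, ∀ x, |u t x - φ (x 0 + c * t)| ≤
      M * exp (-t / 2) + K * exp (l * (x 0 + c * t) - μ * t))
    {G : Rn n → ℝ} (hGm : Measurable G) (hG0 : ∀ x, 0 ≤ G x) (hGi : Integrable G)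
    (hGu : ∀ s ∈ Icc (-τ) 0, ∀ x, |u s x - φ (x 0 + c * s)| ≤ G x)
    {κ m0 : ℝ} (hκ : 0 < κ) (hm0 : 0 < m0) (hm0U : m0 ≤ U / 4)
    (hκm : ∀ r ∈ Icc 0 m0, κ * r ≤ b r - d r) :
    ∃ K2 μ2 : ℝ, 0 < K2 ∧ 0 < μ2 ∧ ∀ t ≥ 0, ∀ x, |u t x - φ (x 0 + c * t)| ≤ K2 * exp (-μ2 * t) := by
  obtain ⟨T, X, m, hT, hm, hmU, hmm0, hX, hum⟩ := stage2 hJ hf hfc hfp hn hτ hU hu hc hl hμ hM hK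
    hmono hlim hst hGm hG0 hGi hGu hκ hm0 hm0U hκm
  -- choose p
  have hhm : 0 < b m - d m := lt_of_lt_of_le (by positivity) (hκm m ⟨hm.le, hmm0⟩)
  have hcont : ContinuousOn (fun r => b r - d r) (Icc 0 U) := hn.bcont.sub hdc
  have hUm : U ∈ Icc 0 U := ⟨hU.le, le_rfl⟩
  have hlim2 : Tendsto (fun ξ => b (φ ξ) - d (φ ξ)) atTop (nhds (b U - d U)) :=
    (hcont U hUm).tendsto.comp
      (tendsto_nhdsWithin_iff.2 ⟨hlim, Eventually.of_forall hφ⟩)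
  rw [hn.eqU, sub_self] at hlim2
  obtain ⟨X2, ⟨hX2a, hX2b⟩, hX2c⟩ := (((hlim2.eventually (gt_mem_nhds hhm)).and
    (hlim.eventually (lt_mem_nhds (by linarith : m < U)))).and (eventually_ge_atTop X)).exists
  set p := φ X2 with hp
  have hpU : p ≤ U := (hφ X2).2
  have hmp : 0 < p - m := by linarith
  set a := (d p - d m) / (p - m) with ha
  set B := (b p - b m) / (p - m) with hB
  have hpm : p ∈ Icc 0 U := hφ X2
  have hmm : m ∈ Icc 0 U := ⟨hm.le, by linarith⟩
  have hB0 : 0 ≤ B := div_nonneg (hn.blo m hmm p hpm (by linarith)) hmp.le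
  have haB : B < a := by
    rw [hB, ha]
    exact div_lt_div_of_pos_right (by linarith) hmp
  have kd : ∀ x y, m ≤ x → p ≤ y → y ≤ U → x ≤ y → a * (y - x) ≤ d y - d x :=
    fun x y h1 h2 h3 h4 => secant_bd hcd hm.le hX2b hpU h1 h2 h3 h4
  have kb : ∀ x y, m ≤ x → p ≤ y → y ≤ U → x ≤ y → b y - b x ≤ B * (y - x) := by
    intro x y h1 h2 h3 h4
    have := secant_bd hcb.neg hm.le hX2b hpU h1 h2 h3 h4
    simp only [Pi.neg_apply] at this
    have e : (-b p - -b m) / (p - m) = -B := by rw [hB]; ring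
    rw [e] at this
    linarith
  refine stage3 (w := fun t x => φ (x 0 + c * t)) (a := a) (B := B) (T := T) (X := X2) (m := m)
    (p := p) hJ hf hn hτ hU hu hw hc hl hμ hM hK hst hT.le ?_ ?_ hB0 haB ?_ ?_
  · exact fun t ht x hx => hum t ht x (hX2c.trans hx)
  · exact fun t ht x hx => hmono hx
  · intro x hx y hy
    rcases le_total x y with h | h
    · rw [abs_sub_comm, abs_sub_comm (d x), abs_of_nonneg (sub_nonneg.2 h)]
      exact (kd x y hx.1 hy.1 hy.2 h).trans (le_abs_self _)
    · rw [abs_of_nonneg (sub_nonneg.2 h)]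
      exact (kd y x (by linarith [hy.1]) (by linarith [hy.1]) hx.2 h).trans (le_abs_self _)
  · intro x hx y hy
    have hx' : x ∈ Icc 0 U := ⟨by linarith [hx.1], hx.2⟩
    have hy' : y ∈ Icc 0 U := ⟨by linarith [hy.1], hy.2⟩
    rcases le_total x y with h | h
    · rw [abs_sub_comm, abs_sub_comm x, abs_of_nonneg (sub_nonneg.2 h),
        abs_of_nonneg (hn.blo x hx' y hy' h)]
      exact kb x y hx.1 hy.1 hy.2 h
    · rw [abs_of_nonneg (sub_nonneg.2 h), abs_of_nonneg (hn.blo y hy' x hx' h)]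
      exact kb y x (by linarith [hy.1]) (by linarith [hy.1]) hx.2 h

lemma gap_choose {A Bb g b0 E τ d0 l c : ℝ} (hg : 0 < g)
    (h : g = c * l - (A - 1) + d0 - b0 * exp (E - l * c * τ)) (hBb : Bb = exp E) :
    ∃ μ γ : ℝ, 0 < μ ∧ μ ≤ 1 / 2 ∧ 0 < γ ∧
      A + b0 * Bb * exp (-l * c * τ + μ * τ) - 1 - d0 + μ - l * c ≤ -γ := by
  have hct : ContinuousAt (fun r : ℝ =>
      A + b0 * Bb * exp (-l * c * τ + r * τ) - 1 - d0 + r - l * c) 0 := by fun_prop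
  have hv : A + b0 * Bb * exp (-l * c * τ + 0 * τ) - 1 - d0 + 0 - l * c < -(g / 2) := by
    have e : Bb * exp (-l * c * τ + 0 * τ) = exp (E - l * c * τ) := by
      rw [hBb, ← exp_add]; ring_nf
    rw [mul_assoc, e]; linarith
  have hev := hct.eventually (gt_mem_nhds hv)
  have hev2 := (hev.filter_mono nhdsWithin_le_nhds : ∀ᶠ r in nhdsWithin (0:ℝ) (Ioi 0), _)
  have hev3 : ∀ᶠ r in nhdsWithin (0:ℝ) (Ioi 0), r < 1/2 :=
    (eventually_lt_nhds (by positivity)).filter_mono nhdsWithin_le_nhds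
  obtain ⟨r, ⟨h1, h2⟩, h3⟩ := ((hev2.and hev3).and self_mem_nhdsWithin).exists
  exact ⟨r, g / 2, h3, h2.le, by positivity, h1.le⟩

/-- global exponential stability of noncritical planar traveling
waves, `c > c*`, with time-delay `τ > 0`. -/
theorem stability_noncritical_delay {n : ℕ} [NeZero n]
    (d b d' b' d'' b'' : ℝ → ℝ) (uplus : ℝ)
    -- (H1)
    (huplus : 0 < uplus) (hd0 : d 0 = 0) (hb0 : b 0 = 0) (hdbu : d uplus = b uplus)
    (hd'def : ∀ u ∈ Set.Icc 0 uplus, HasDerivAt d (d' u) u)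
    (hb'def : ∀ u ∈ Set.Icc 0 uplus, HasDerivAt b (b' u) u)
    (hd''def : ∀ u ∈ Set.Icc 0 uplus, HasDerivAt d' (d'' u) u)
    (hb''def : ∀ u ∈ Set.Icc 0 uplus, HasDerivAt b' (b'' u) u)
    (hd''cont : ContinuousOn d'' (Set.Icc 0 uplus))
    (hb''cont : ContinuousOn b'' (Set.Icc 0 uplus))
    -- (H2)
    (h2a : d' 0 < b' 0) (h2b : 0 ≤ d' 0) (h2c : 0 ≤ b' uplus) (h2d : b' uplus < d' uplus)
    -- (H3)
    (h3 : ∀ u ∈ Set.Icc 0 uplus, 0 ≤ d' u ∧ 0 ≤ b' u ∧ 0 ≤ d'' u ∧ b'' u ≤ 0)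
    -- (J1): J is a product of smooth, even, nonnegative, unit-mass 1-D kernels
    (J₁ : Fin n → ℝ → ℝ) (J : Rn n → ℝ)
    (hJprod : ∀ x : Rn n, J x = ∏ i, J₁ i (x i))
    (hJsmooth : ∀ i, ContDiff ℝ (⊤ : ℕ∞) (J₁ i))
    (hJeven : ∀ i, ∀ y : ℝ, J₁ i (-y) = J₁ i y)
    (hJpos : ∀ i, ∀ y : ℝ, 0 ≤ J₁ i y)
    (hJunit : ∀ i, (∫ y : ℝ, J₁ i y) = 1)
    -- (J2): Ĵ(ξ) = 1 - 𝒦|ξ|^α + o(|ξ|^α) as ξ → 0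
    (Kcal alpha : ℝ) (hK : 0 < Kcal) (hal : 0 < alpha) (hal2 : alpha ≤ 2)
    (hJ2 : (fun ξ : Rn n => (FT J ξ).re - (1 - Kcal * ‖ξ‖ ^ alpha))
        =o[nhds 0] fun ξ : Rn n => ‖ξ‖ ^ alpha)
    (hJ1exp : ∀ lam > (0 : ℝ), Integrable (fun y : ℝ => J₁ 0 y * Real.exp (-lam * y)))
    (τ β : ℝ) (hτ : 0 < τ) (hβ : 0 < β)
    (cstar lamstar : ℝ) (hcstar : 0 < cstar) (hlamstar : 0 < lamstar)
    (htan : (b' 0 * Real.exp (β * lamstar ^ 2 - lamstar * cstar * τ)) = (cstar * lamstar - ((∫ y : ℝ, J₁ 0 y * Real.exp (-lamstar * y)) - 1) + d' 0))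
    (htan' : ∃ slope : ℝ,
      HasDerivAt (fun lam => b' 0 * Real.exp (β * lam ^ 2 - lam * cstar * τ)) slope lamstar ∧
      HasDerivAt (fun lam =>
        cstar * lam - ((∫ y : ℝ, J₁ 0 y * Real.exp (-lam * y)) - 1) + d' 0) slope lamstar)
    (c : ℝ) (hc : cstar < c)
    (φ φd : ℝ → ℝ) (hmono : Monotone φ)
    (hphid : ∀ ξ : ℝ, HasDerivAt φ (φd ξ) ξ) (hphidcont : Continuous φd)
    (hlim0 : Filter.Tendsto φ Filter.atBot (nhds 0))
    (hlimup : Filter.Tendsto φ Filter.atTop (nhds uplus))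
    (hTW : ∀ ξ : ℝ, c * φd ξ - (∫ y : ℝ, J₁ 0 (ξ - y) * φ y) + φ ξ + d (φ ξ)
        = ∫ y : ℝ, heatKernel1 β y * b (φ (ξ - y - c * τ)))
    (xstar : ℝ) (hxstar : 0 < xstar)
    (hxstar1 : 0 < d' (φ xstar)
        - ∫ y : Rn n, heatKernel n β y * b' (φ (xstar - y 0 - c * τ)))
    (hxstar2 : d' (φ xstar)
        - (∫ y : Rn n, heatKernel n β y * b' (φ (xstar - y 0 - c * τ)))
      < d' uplus - b' uplus)
    (m : ℕ) (hm : (n : ℝ) / 2 < (m : ℝ))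
    (u₀ u₀s : ℝ → Rn n → ℝ)
    (hu₀bd : ∀ s ∈ Set.Icc (-τ) 0, ∀ x : Rn n, 0 ≤ u₀ s x ∧ u₀ s x ≤ uplus)
    -- u₀ - φ ∈ C([-τ,0]; H^m_w(ℝⁿ) ∩ L¹_w(ℝⁿ))
    (hu₀cont : ContinuousOn (fun p : ℝ × Rn n => u₀ p.1 p.2 - φ (p.2 0 + c * p.1))
      (Set.Icc (-τ) 0 ×ˢ Set.univ))
    (hu₀L1w : ∀ s ∈ Set.Icc (-τ) 0,
      Integrable (fun x : Rn n => wgt lamstar xstar (x 0) * |u₀ s x - φ (x 0 + c * s)|))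
    (hu₀Hmw : ∀ s ∈ Set.Icc (-τ) 0, ∀ j : Fin n → Fin (m + 1), (∑ i, (j i : ℕ)) ≤ m →
      Integrable (fun x : Rn n => wgt lamstar xstar (x 0)
        * (mpd (fun i => (j i : ℕ)) (fun x : Rn n => u₀ s x - φ (x 0 + c * s)) x) ^ 2))
    -- ∂ₛ(u₀ - φ) ∈ L¹([-τ,0]; H^m_w(ℝⁿ) ∩ L¹_w(ℝⁿ))
    (hu₀s : ∀ s ∈ Set.Icc (-τ) 0, ∀ x : Rn n,
      HasDerivAt (fun s => u₀ s x - φ (x 0 + c * s)) (u₀s s x) s)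
    (hu₀sL1w : ∀ s ∈ Set.Icc (-τ) 0,
      Integrable (fun x : Rn n => wgt lamstar xstar (x 0) * |u₀s s x|))
    (hu₀sHmw : ∀ s ∈ Set.Icc (-τ) 0, ∀ j : Fin n → Fin (m + 1), (∑ i, (j i : ℕ)) ≤ m →
      Integrable (fun x : Rn n => wgt lamstar xstar (x 0)
        * (mpd (fun i => (j i : ℕ)) (u₀s s) x) ^ 2))
    (hu₀sInt : IntegrableOn
      (fun s => (∫ x : Rn n, wgt lamstar xstar (x 0) * |u₀s s x|)
        + (HSobSqW (wgt lamstar xstar) m (u₀s s)) ^ ((1 : ℝ) / 2))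
      (Set.Icc (-τ) 0))
 :
    ∃ u ut : ℝ → Rn n → ℝ,
      (ContinuousOn (fun p : ℝ × Rn n => u p.1 p.2) (Set.Ici (-τ) ×ˢ Set.univ) ∧
      (∀ s ∈ Set.Icc (-τ) 0, ∀ x : Rn n, u s x = u₀ s x) ∧
      (∀ x : Rn n, ContinuousOn (fun t => ut t x) (Set.Ioi 0)) ∧
      (∀ t > (0 : ℝ), ∀ x : Rn n, HasDerivAt (fun t => u t x) (ut t x) t) ∧
      (∀ t > (0 : ℝ), ∀ x : Rn n,
        ut t x - (∫ y : Rn n, J (x - y) * u t y) + u t x + d (u t x)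
          = ∫ y : Rn n, heatKernel n β y * b (u (t - τ) (x - y))) ∧
      (∀ t ≥ (0 : ℝ), ∀ x : Rn n, 0 ≤ u t x ∧ u t x ≤ uplus)) ∧
      (∀ u' ut' : ℝ → Rn n → ℝ,
        (ContinuousOn (fun p : ℝ × Rn n => u' p.1 p.2) (Set.Ici (-τ) ×ˢ Set.univ) ∧
      (∀ s ∈ Set.Icc (-τ) 0, ∀ x : Rn n, u' s x = u₀ s x) ∧
      (∀ x : Rn n, ContinuousOn (fun t => ut' t x) (Set.Ioi 0)) ∧
      (∀ t > (0 : ℝ), ∀ x : Rn n, HasDerivAt (fun t => u' t x) (ut' t x) t) ∧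
      (∀ t > (0 : ℝ), ∀ x : Rn n,
        ut' t x - (∫ y : Rn n, J (x - y) * u' t y) + u' t x + d (u' t x)
          = ∫ y : Rn n, heatKernel n β y * b (u' (t - τ) (x - y))) ∧
      (∀ t ≥ (0 : ℝ), ∀ x : Rn n, 0 ≤ u' t x ∧ u' t x ≤ uplus)) →
        ∀ t ≥ -τ, ∀ x : Rn n, u' t x = u t x) ∧
      ∃ ε₁ : ℝ, 0 < ε₁ ∧ ε₁ < 1 ∧ ∃ mu : ℝ, 0 < mu ∧
        mu < min (d' uplus - b' uplus)
          (ε₁ * ((c * lamstar - ((∫ y : ℝ, J₁ 0 y * Real.exp (-lamstar * y)) - 1) + d' 0) - (b' 0 * Real.exp (β * lamstar ^ 2 - lamstar * c * τ)))) ∧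
        ∃ C > (0 : ℝ), ∀ t > (0 : ℝ), ∀ x : Rn n,
          |u t x - φ (x 0 + c * t)|
            ≤ C * (1 + t) ^ (-((n : ℝ) / alpha)) * Real.exp (-mu * t) := by
  obtain rfl : J = fun x : Rn n => ∏ i, J₁ i (x i) := funext hJprod
  have hc0 : 0 < c := hcstar.trans hc
  obtain ⟨hn, hcd, hcb⟩ := NL_of huplus hd0 hb0 hdbu hd'def hb'def hd''def hb''def h3
  have hJk : Kern (fun x : Rn n => ∏ i, J₁ i (x i)) := Kern.of_prod hJpos hJunit
  have hfk := heat_kern n hβ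
  have hmem := wave_mem hmono hlim0 hlimup
  have hw := wave_sol (n := n) (τ := τ) hβ hJunit hmem hphid hTW
  have hφc : Continuous φ := continuous_iff_continuousAt.2 fun x => (hphid x).continuousAt
  have hJm : Measurable (fun x : Rn n => ∏ i, J₁ i (x i)) := by
    have : Continuous (fun x : Rn n => ∏ i, J₁ i (x i)) :=
      continuous_finsetProd _ fun i _ => (hJsmooth i).continuous.comp (by fun_prop)
    exact this.measurable
  -- existence
  have hu₀c : ContinuousOn (fun p : ℝ × Rn n => u₀ p.1 p.2) (Icc (-τ) 0 ×ˢ univ) := by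
    have h1 : Continuous (fun p : ℝ × Rn n => φ (p.2 0 + c * p.1)) := by fun_prop
    refine (hu₀cont.add h1.continuousOn).congr fun p _ => ?_
    simp
  obtain ⟨u, hu, hu0, hucont⟩ := exists_sol2 hJk hfk hn hτ huplus hu₀c hu₀bd
  -- initial data majorant
  have hv : ∀ s ∈ Icc (-τ) 0, ∀ x : Rn n, |u₀ s x - φ (x 0 + c * s)| ≤ uplus := by
    intro s hs x
    have h1 := hu₀bd s hs x
    have h2 := hmem (x 0 + c * s)
    rw [abs_le]; constructor <;> linarith [h1.1, h1.2, h2.1, h2.2]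
  have hwn : ∀ y, 0 ≤ wgt lamstar xstar y := fun y => zero_le_one.trans (wgt_ge_one hlamstar)
  have hsI : ∫⁻ s in Icc (-τ) 0,
      ENNReal.ofReal (∫ x : Rn n, wgt lamstar xstar (x 0) * |u₀s s x|) < ⊤ := by
    refine lt_of_le_of_lt (lintegral_mono fun s => ENNReal.ofReal_le_ofReal ?_)
      (Integrable.lintegral_lt_top hu₀sInt)
    refine le_add_of_nonneg_right (rpow_nonneg ?_ _)
    unfold HSobSqW
    exact Finset.sum_nonneg fun j _ => integral_nonneg fun x => mul_nonneg (hwn _) (sq_nonneg _)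
  obtain ⟨G, hGm, hG0, hGU, hGv, hGi, hGl⟩ := G_exists (v := fun s x => u₀ s x - φ (x 0 + c * s))
    (vs := u₀s) hτ hlamstar huplus.le hu₀cont hv (hu₀L1w 0 ⟨by linarith, le_rfl⟩) hu₀s hu₀sL1w hsI
  have hJl : Integrable (fun y : Rn n => (∏ i, J₁ i (y i)) * exp (-lamstar * y 0)) :=
    prod_integrable0 J₁ (fun i => integrable_of_int_one (hJunit i)) (fun y => exp (-lamstar * y))
      (hJ1exp lamstar hlamstar)
  have hJv : ∫ y : Rn n, (∏ i, J₁ i (y i)) * exp (-lamstar * y 0) =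
      ∫ y : ℝ, J₁ 0 y * exp (-lamstar * y) :=
    prod_integral0 J₁ hJunit (fun y => exp (-lamstar * y))
  obtain ⟨hfl, hfv⟩ := heat_exp_int (n := n) hβ lamstar
  obtain ⟨q, M, C1, hqm, hq0, hqM, hC1, hGq, hqJ, hqf⟩ := q_exists hJk hJm hfk
    (heat_cont β).measurable (by positivity) hJl (heat_exp_bound n hβ lamstar) hGm hG0 hGU hGl
  have hM : 0 ≤ M := (hq0 0).trans (hqM 0)
  -- the gap
  have hgap : 0 < (c * lamstar - ((∫ y : ℝ, J₁ 0 y * Real.exp (-lamstar * y)) - 1) + d' 0)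
      - (b' 0 * Real.exp (β * lamstar ^ 2 - lamstar * c * τ)) := by
    have h1 : exp (β * lamstar ^ 2 - lamstar * c * τ) ≤
        exp (β * lamstar ^ 2 - lamstar * cstar * τ) := by
      refine exp_le_exp.2 ?_
      have : 0 < lamstar * τ * (c - cstar) :=
        mul_pos (mul_pos hlamstar hτ) (by linarith)
      linarith
    have h2 := mul_le_mul_of_nonneg_left h1 (show 0 ≤ b' 0 by linarith)
    have h4 : cstar * lamstar < c * lamstar := mul_lt_mul_of_pos_right hc hlamstar
    linarith
  obtain ⟨μ, γ, hμ, hμ1, hγ, hineq⟩ := gap_choose (A := ∫ y : ℝ, J₁ 0 y * exp (-lamstar * y))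
    hgap rfl rfl
  rw [← hJv, ← hfv] at hineq
  have hini : ∀ s ∈ Icc (-τ) 0, ∀ x, |u s x - φ (x 0 + c * s)| ≤ G x := by
    intro s hs x
    rw [hu0 s hs x]; exact hGv s hs x
  obtain ⟨K, hK0, hst⟩ := stage1 hJk hfk hn hτ hu hw hlamstar hc0 hJl hfl hqm hq0 hqM hC1
    (fun s hs x => (hini s hs x).trans (hGq x)) hqJ hqf hγ hμ1 hineq
  have h0m : (0:ℝ) ∈ Icc 0 uplus := ⟨le_rfl, huplus.le⟩
  obtain ⟨κ, m0, hκ, hm0, hm0U, hκm⟩ := kappa_exists (h := fun r => b r - d r)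
    (k := b' 0 - d' 0) (by linarith) huplus (by simp [hb0, hd0])
    ((hb'def 0 h0m).sub (hd'def 0 h0m))
  obtain ⟨K2, μ2, hK2, hμ2, hdecay⟩ := stage23 hJk hfk (heat_cont β) (heat_pos hβ) hn
    (fun x hx => (hd'def x hx).continuousAt.continuousWithinAt) hcd hcb hτ huplus hu hw hmem hc0
    hlamstar hμ hM hK0 hmono hlimup hst hGm hG0 hGi hini hκ hm0 hm0U hκm
  refine ⟨u, fun t x => cv (fun x : Rn n => ∏ i, J₁ i (x i)) (u t) x - u t x - d (u t x)
    + cv (heatKernel n β) (fun y => b (u (t - τ) y)) x,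
    ⟨hu.cont, hu0, fun x => (hucont x).continuousOn, hu.der, ?_, ?_⟩, ?_, ?_⟩
  · intro t ht x
    have h1 := cv_form (fun x : Rn n => ∏ i, J₁ i (x i)) (u t) x
    simp only at h1
    rw [h1]
    unfold cv
    ring
  · exact fun t ht x => hu.mem t (by linarith) x
  · rintro u' ut' ⟨h1, h2, h3', h4, h5, h6⟩
    refine sol_unique hJk hfk hn hτ ⟨h1, ?_, ?_⟩ hu ?_
    · intro t ht x
      rcases le_or_gt t 0 with h | h
      · rw [h2 t ⟨ht, h⟩ x]; exact hu₀bd t ⟨ht, h⟩ x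
      · exact h6 t h.le x
    · intro t ht x
      refine (h4 t ht x).congr_deriv ?_
      have e1 := cv_form (fun x : Rn n => ∏ i, J₁ i (x i)) (u' t) x
      have e2 := h5 t ht x
      simp only at e1 e2
      rw [e1] at e2
      have e3 : cv (heatKernel n β) (fun y => b (u' (t - τ) y)) x =
        ∫ y : Rn n, heatKernel n β y * b (u' (t - τ) (x - y)) := rfl
      rw [e3, ← e2]; ring
    · intro s hs x
      rw [h2 s hs x, hu0 s hs x]
  · have hmin : 0 < min (min (d' uplus - b' uplus)
          (1 / 2 * ((c * lamstar - ((∫ y : ℝ, J₁ 0 y * Real.exp (-lamstar * y)) - 1) + d' 0) - (b' 0 * Real.exp (β * lamstar ^ 2 - lamstar * c * τ))))) μ2 :=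
      lt_min (lt_min (by linarith) (by linarith)) hμ2
    obtain ⟨mu, hmu0, hmu⟩ := exists_between hmin
    refine ⟨1 / 2, by norm_num, by norm_num, mu, hmu0, hmu.trans_le (min_le_left _ _), ?_⟩
    obtain ⟨C, hC, hCt⟩ := final_rate (r := (n : ℝ) / alpha) hK2
      (hmu.trans_le (min_le_right _ _)) (by positivity)
    exact ⟨C, hC, fun t ht x => (hdecay t ht.le x).trans (hCt t ht)⟩


end
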